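/- arXiv:1708.05381 — 2 statements merged into one kernel-verified Lean document; each statement's English description precedes it below -/
import Mathlib

section
/- Vertical-axis generating function: for every real w with |w| < 1, ∑_{k≥1} g(0,2k)·w^{2k} = w²·(√2/√(1−w²) − 1)/(1+w²). -/
/-- `g` is a slit-plane Green's function: the voltage `G_H` on the half-plane square
lattice `{(x,y) : y ≥ 0, x+y even}` with Dirichlet boundary on the negative `x`-axis,
reflecting boundary on the positive `x`-axis, and one unit of current inserted at the
origin. -/
def IsSlitGreen (g : ℤ × ℤ → ℝ) : Prop :=
  -- g vanishes off the half-plane lattice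
  (∀ x y : ℤ, (y < 0 ∨ Odd (x + y)) → g (x, y) = 0) ∧
  -- (i) Dirichlet boundary on the negative x-axis
  (∀ x : ℤ, x < 0 → g (x, 0) = 0) ∧
  -- (ii) harmonicity off the x-axis
  (∀ x y : ℤ, 1 ≤ y → Even (x + y) →
    4 * g (x, y) =
      g (x - 1, y - 1) + g (x + 1, y - 1) + g (x - 1, y + 1) + g (x + 1, y + 1)) ∧
  -- (iii) reflecting boundary on the positive x-axis
  (∀ x : ℤ, 0 < x → Even x → 2 * g (x, 0) = g (x - 1, 1) + g (x + 1, 1)) ∧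
  -- (iv) one unit of current inserted at the origin
  (2 * g (0, 0) - g (1, 1) - g (-1, 1) = 1) ∧
  -- (v) values between 0 and 1
  (∀ x y : ℤ, 0 ≤ g (x, y) ∧ g (x, y) ≤ 1) ∧
  -- (vi) decay at infinity
  (∀ ε : ℝ, 0 < ε → ∃ N : ℕ, ∀ x y : ℤ, (N : ℤ) ≤ |x| + |y| → |g (x, y)| < ε)

open Real MeasureTheory Set Filter Topology

/-- The angle in `[-π/4, π/4]` whose sine is `sin t / √2`. -/
noncomputable def slitAngle (t : ℝ) : ℝ := arcsin (sin t / √2)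

theorem sin_slitAngle (t : ℝ) : sin (slitAngle t) = sin t / √2 := by
  have h2 : (1 : ℝ) ≤ √2 := Real.one_le_sqrt.2 (by norm_num)
  have h0 : (0 : ℝ) < √2 := by positivity
  refine sin_arcsin ?_ ?_
  · rw [le_div_iff₀ h0]; linarith [neg_one_le_sin t]
  · rw [div_le_iff₀ h0]; linarith [sin_le_one t]

theorem two_mul_sin_sq_slitAngle (t : ℝ) : 2 * sin (slitAngle t) ^ 2 = sin t ^ 2 := by
  rw [sin_slitAngle, div_pow, sq_sqrt (by norm_num)]; ring

theorem cos_slitAngle_pos (t : ℝ) : 0 < cos (slitAngle t) := by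
  have h : 0 ≤ cos (slitAngle t) := cos_arcsin_nonneg _
  refine h.lt_of_ne' fun h0 => ?_
  have h1 := two_mul_sin_sq_slitAngle t
  have h2 := sin_sq_add_cos_sq (slitAngle t)
  rw [h0] at h2
  nlinarith [sin_sq_le_one t]

theorem cos_two_mul_slitAngle (t : ℝ) : cos (2 * slitAngle t) = cos t ^ 2 := by
  have h1 := two_mul_sin_sq_slitAngle t
  have h2 := sin_sq_add_cos_sq (slitAngle t)
  have h3 := sin_sq_add_cos_sq t
  rw [cos_two_mul]; linarith

theorem hasDerivAt_slitAngle (t : ℝ) :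
    HasDerivAt slitAngle (cos t / (√2 * cos (slitAngle t))) t := by
  have h0 : (0 : ℝ) < √2 := by positivity
  have hc := cos_slitAngle_pos t
  have h2 := sin_sq_add_cos_sq (slitAngle t)
  have hs := sin_slitAngle t
  have hne1 : sin t / √2 ≠ -1 := by
    intro h; rw [hs, h] at h2; nlinarith
  have hne2 : sin t / √2 ≠ 1 := by
    intro h; rw [hs, h] at h2; nlinarith
  have h := (hasDerivAt_arcsin hne1 hne2).comp t ((hasDerivAt_sin t).div_const √2)
  refine h.congr_deriv ?_
  rw [← cos_arcsin]
  change 1 / cos (slitAngle t) * _ = _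
  field_simp

theorem continuous_slitAngle : Continuous slitAngle :=
  continuous_iff_continuousAt.2 fun t => (hasDerivAt_slitAngle t).continuousAt

theorem tan_sq_slitAngle (t : ℝ) : tan (slitAngle t) ^ 2 = sin t ^ 2 / (2 - sin t ^ 2) := by
  have hc := cos_slitAngle_pos t
  have h1 := two_mul_sin_sq_slitAngle t
  have h2 := sin_sq_add_cos_sq (slitAngle t)
  rw [tan_eq_sin_div_cos, div_pow, div_eq_div_iff (by positivity) (by nlinarith)]
  nlinarith

theorem abs_tan_slitAngle_le_one (t : ℝ) : |tan (slitAngle t)| ≤ 1 := by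
  rw [← sq_le_one_iff_abs_le_one, tan_sq_slitAngle,
    div_le_one (by nlinarith [sin_sq_le_one t])]
  nlinarith [sin_sq_le_one t]

theorem abs_tan_slitAngle_lt_one {t : ℝ} (ht : 0 < cos t) : |tan (slitAngle t)| < 1 := by
  have := sin_sq_add_cos_sq t
  rw [← sq_lt_one_iff_abs_lt_one, tan_sq_slitAngle,
    div_lt_one (by nlinarith [sin_sq_le_one t])]
  nlinarith

theorem inv_cos_slitAngle_le (t : ℝ) : (cos (slitAngle t))⁻¹ ≤ 2 := by
  have hc := cos_slitAngle_pos t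
  have h1 := two_mul_sin_sq_slitAngle t
  have h2 := sin_sq_add_cos_sq (slitAngle t)
  have := sin_sq_le_one t
  rw [inv_le_comm₀ hc (by norm_num)]
  nlinarith

theorem continuous_tan_slitAngle : Continuous fun t => tan (slitAngle t) := by
  simp only [tan_eq_sin_div_cos]
  exact (continuous_sin.comp continuous_slitAngle).div
    (continuous_cos.comp continuous_slitAngle) fun t => (cos_slitAngle_pos t).ne'

/-- The moment integrals evaluated on the boundary rows. -/
noncomputable def slitMoment (p : ℕ) (x : ℤ) : ℝ :=
  ∫ t in -(π / 2)..(π / 2), cos ((2 * x + 1) * slitAngle t) / cos (slitAngle t) * cos t ^ p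

theorem slitMoment_rec (p : ℕ) (x : ℤ) :
    (2 * x + p) * slitMoment p x + (2 * x - 2 - p) * slitMoment p (x - 2) = 0 := by
  have hcont (y : ℤ) : Continuous fun t =>
      cos ((2 * y + 1) * slitAngle t) / cos (slitAngle t) * cos t ^ p :=
    ((continuous_cos.comp (continuous_const.mul continuous_slitAngle)).div
      (continuous_cos.comp continuous_slitAngle) fun t => (cos_slitAngle_pos t).ne').mul
      (continuous_cos.pow p)
  have hderiv (t : ℝ) : HasDerivAt
      (fun t => 2 * √2 * (cos t ^ (p + 1) * sin ((2 * x - 1) * slitAngle t)))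
      ((2 * x + p) * (cos ((2 * x + 1) * slitAngle t) / cos (slitAngle t) * cos t ^ p) +
        (2 * x - 2 - p) *
          (cos ((2 * (x - 2 : ℤ) + 1) * slitAngle t) / cos (slitAngle t) * cos t ^ p)) t := by
    have h := ((((hasDerivAt_cos t).pow (p + 1)).mul
      ((hasDerivAt_slitAngle t).const_mul (2 * (x : ℝ) - 1)).sin)).const_mul (2 * √2)
    refine h.congr_deriv ?_
    have hc := (cos_slitAngle_pos t).ne'
    have h0 : √2 ≠ 0 := by positivity
    have hs : sin t = √2 * sin (slitAngle t) := by rw [sin_slitAngle]; field_simp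
    have hcc := cos_two_mul_slitAngle t
    have e1 : (2 * (x : ℝ) + 1) * slitAngle t =
      (2 * x - 1) * slitAngle t + 2 * slitAngle t := by ring
    have e2 : (2 * ((x - 2 : ℤ) : ℝ) + 1) * slitAngle t =
      (2 * x - 1) * slitAngle t - 2 * slitAngle t := by push_cast; ring
    rw [e1, e2, cos_add, cos_sub, hcc, sin_two_mul, hs]
    have hsq : √2 ^ 2 = 2 := sq_sqrt (by norm_num)
    simp only [Nat.add_sub_cancel, Pi.pow_apply]
    push_cast
    field_simp
    rw [hsq]
    ring
  have h := intervalIntegral.integral_eq_sub_of_hasDerivAt (a := -(π / 2)) (b := π / 2)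
    (fun t _ => hderiv t)
    ((((hcont x).const_mul _).add ((hcont (x - 2)).const_mul _)).intervalIntegrable _ _)
  rw [intervalIntegral.integral_add (((hcont x).const_mul _).intervalIntegrable _ _)
    (((hcont (x - 2)).const_mul _).intervalIntegrable _ _),
    intervalIntegral.integral_const_mul, intervalIntegral.integral_const_mul] at h
  simpa [slitMoment] using h

theorem slitMoment_zero_of_neg (n : ℕ) : slitMoment 0 (-2 * (n + 1)) = 0 := by
  induction n with
  | zero => have := slitMoment_rec 0 0; norm_num at this ⊢; exact this
  | succ n ih =>
    have h := slitMoment_rec 0 (-2 * (n + 1))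
    rw [ih] at h
    have e : (-2 * ((n : ℤ) + 1) - 2) = -2 * ((n + 1 : ℕ) + 1) := by push_cast; ring
    rw [e] at h
    push_cast at h ⊢
    have : (2 * (-2 * ((n : ℝ) + 1)) - 2 - 0) ≠ 0 := by
      have : (0 : ℝ) ≤ n := n.cast_nonneg
      intro h; linarith
    rw [mul_zero, zero_add] at h
    exact (mul_eq_zero.1 h).resolve_left this

theorem slitMoment_two_of_pos (n : ℕ) : slitMoment 2 (2 * (n + 1)) = 0 := by
  induction n with
  | zero => have := slitMoment_rec 2 2; norm_num at this ⊢; exact this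
  | succ n ih =>
    have h := slitMoment_rec 2 (2 * ((n + 1 : ℕ) + 1))
    have e : (2 * (((n + 1 : ℕ) : ℤ) + 1) - 2) = 2 * (n + 1) := by push_cast; ring
    rw [e, ih] at h
    push_cast at h ⊢
    have : (2 * (2 * ((n : ℝ) + 1 + 1)) + 2) ≠ 0 := by positivity
    simpa [this] using h

theorem slitMoment_two_zero : slitMoment 2 0 = π / 2 := by
  have h (t : ℝ) : cos ((2 * (0 : ℤ) + 1) * slitAngle t) / cos (slitAngle t) * cos t ^ 2 =
      cos t ^ 2 := by
    have := (cos_slitAngle_pos t).ne'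
    simp [this]
  simp only [slitMoment, h, integral_cos_sq]
  simp

/-- For each `t`, a harmonic function of `(x, n)` on the half-plane lattice. -/
noncomputable def slitKernel (x : ℤ) (n : ℕ) (t : ℝ) : ℝ :=
  cos ((2 * x + 1) * slitAngle t - x * (π / 2)) / cos (slitAngle t) * tan (slitAngle t) ^ n

theorem continuous_slitKernel (x : ℤ) (n : ℕ) : Continuous (slitKernel x n) :=
  ((continuous_cos.comp ((continuous_const.mul continuous_slitAngle).sub continuous_const)).div
    (continuous_cos.comp continuous_slitAngle) fun t => (cos_slitAngle_pos t).ne').mul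
    (continuous_tan_slitAngle.pow n)

/-- An explicit integral formula for the slit-plane Green's function. -/
noncomputable def slitPotential (x : ℤ) (n : ℕ) : ℝ :=
  π⁻¹ * ∫ t in -(π / 2)..(π / 2), slitKernel x n t

theorem slitKernel_neighbors (x : ℤ) (n : ℕ) (t : ℝ) :
    slitKernel (x - 1) n t + slitKernel (x + 1) n t =
      2 * sin (2 * slitAngle t) * slitKernel x n t := by
  have e1 : (2 * ((x - 1 : ℤ) : ℝ) + 1) * slitAngle t - ((x - 1 : ℤ) : ℝ) * (π / 2) =
    ((2 * x + 1) * slitAngle t - x * (π / 2)) - (2 * slitAngle t - π / 2) := by push_cast; ring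
  have e2 : (2 * ((x + 1 : ℤ) : ℝ) + 1) * slitAngle t - ((x + 1 : ℤ) : ℝ) * (π / 2) =
    ((2 * x + 1) * slitAngle t - x * (π / 2)) + (2 * slitAngle t - π / 2) := by push_cast; ring
  rw [slitKernel, slitKernel, slitKernel, e1, e2, cos_add, cos_sub _ (2 * slitAngle t - π / 2),
    cos_sub_pi_div_two]
  ring

theorem slitPotential_harmonic (x : ℤ) (n : ℕ) :
    4 * slitPotential x (n + 1) = slitPotential (x - 1) n + slitPotential (x + 1) n +
      slitPotential (x - 1) (n + 2) + slitPotential (x + 1) (n + 2) := by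
  have hi (x : ℤ) (n : ℕ) := (continuous_slitKernel x n).intervalIntegrable (μ := volume)
    (-(π / 2)) (π / 2)
  have key (t : ℝ) : 4 * slitKernel x (n + 1) t = slitKernel (x - 1) n t + slitKernel (x + 1) n t +
      slitKernel (x - 1) (n + 2) t + slitKernel (x + 1) (n + 2) t := by
    rw [add_assoc, slitKernel_neighbors, slitKernel_neighbors]
    have hc := (cos_slitAngle_pos t).ne'
    have htan : sin (2 * slitAngle t) * (1 + tan (slitAngle t) ^ 2) = 2 * tan (slitAngle t) := by
      rw [sin_two_mul, tan_eq_sin_div_cos]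
      field_simp
      linear_combination sin (slitAngle t) * sin_sq_add_cos_sq (slitAngle t)
    simp only [slitKernel]
    linear_combination (-2) * (cos ((2 * x + 1) * slitAngle t - x * (π / 2)) /
      cos (slitAngle t) * tan (slitAngle t) ^ n) * htan
  simp only [slitPotential, ← mul_add]
  rw [mul_left_comm, ← intervalIntegral.integral_const_mul]
  simp only [key]
  rw [intervalIntegral.integral_add (((hi _ _).add (hi _ _)).add (hi _ _)) (hi _ _),
    intervalIntegral.integral_add ((hi _ _).add (hi _ _)) (hi _ _),
    intervalIntegral.integral_add (hi _ _) (hi _ _)]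

theorem cos_slitKernel_phase (m : ℤ) (t : ℝ) :
    cos ((2 * ((2 * m : ℤ) : ℝ) + 1) * slitAngle t - ((2 * m : ℤ) : ℝ) * (π / 2)) =
      (-1) ^ m * cos ((2 * ((2 * m : ℤ) : ℝ) + 1) * slitAngle t) := by
  rw [← cos_sub_int_mul_pi]
  congr 1
  push_cast
  ring

theorem slitPotential_row_zero (m : ℤ) :
    slitPotential (2 * m) 0 = π⁻¹ * ((-1) ^ m * slitMoment 0 (2 * m)) := by
  rw [slitPotential, slitMoment, ← intervalIntegral.integral_const_mul ((-1) ^ m)]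
  congr 2
  funext t
  rw [slitKernel, cos_slitKernel_phase]
  ring

theorem slitPotential_flux (m : ℤ) :
    2 * slitPotential (2 * m) 0 - slitPotential (2 * m - 1) 1 - slitPotential (2 * m + 1) 1 =
      2 * π⁻¹ * ((-1) ^ m * slitMoment 2 (2 * m)) := by
  have hi (x : ℤ) (n : ℕ) := (continuous_slitKernel x n).intervalIntegrable (μ := volume)
    (-(π / 2)) (π / 2)
  have key (t : ℝ) : 2 * slitKernel (2 * m) 0 t - (slitKernel (2 * m - 1) 1 t +
      slitKernel (2 * m + 1) 1 t) = 2 * (-1) ^ m *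
      (cos ((2 * ((2 * m : ℤ) : ℝ) + 1) * slitAngle t) / cos (slitAngle t) * cos t ^ 2) := by
    rw [slitKernel_neighbors, slitKernel, slitKernel, cos_slitKernel_phase,
      ← cos_two_mul_slitAngle, cos_two_mul, sin_two_mul, tan_eq_sin_div_cos]
    have hc := (cos_slitAngle_pos t).ne'
    field_simp
    linear_combination (-2) * cos ((2 * ((2 * m : ℤ) : ℝ) + 1) * slitAngle t) *
      sin_sq_add_cos_sq (slitAngle t)
  calc _ = π⁻¹ * ∫ t in -(π / 2)..(π / 2), 2 * slitKernel (2 * m) 0 t -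
        (slitKernel (2 * m - 1) 1 t + slitKernel (2 * m + 1) 1 t) := by
        rw [intervalIntegral.integral_sub ((hi _ _).const_mul _) ((hi _ _).add (hi _ _)),
          intervalIntegral.integral_add (hi _ _) (hi _ _), intervalIntegral.integral_const_mul]
        simp only [slitPotential]
        ring
    _ = _ := by
        simp only [key]
        rw [intervalIntegral.integral_const_mul, slitMoment]
        ring

theorem slitPotential_row_zero_of_neg {m : ℤ} (hm : m < 0) : slitPotential (2 * m) 0 = 0 := by
  obtain ⟨n, rfl⟩ : ∃ n : ℕ, m = -(n + 1) := ⟨(-m - 1).toNat, by omega⟩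
  have e : (2 * -((n : ℤ) + 1)) = -2 * (n + 1) := by ring
  rw [slitPotential_row_zero, e, slitMoment_zero_of_neg]
  simp

theorem slitPotential_flux_of_pos {m : ℤ} (hm : 0 < m) :
    2 * slitPotential (2 * m) 0 = slitPotential (2 * m - 1) 1 + slitPotential (2 * m + 1) 1 := by
  obtain ⟨n, rfl⟩ : ∃ n : ℕ, m = n + 1 := ⟨(m - 1).toNat, by omega⟩
  have h := slitPotential_flux (n + 1)
  rw [slitMoment_two_of_pos] at h
  linarith

theorem slitPotential_flux_zero :
    2 * slitPotential 0 0 - slitPotential (-1) 1 - slitPotential 1 1 = 1 := by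
  have h := slitPotential_flux 0
  norm_num at h
  rw [h, slitMoment_two_zero]
  have := pi_ne_zero
  field_simp

theorem abs_slitKernel_le (x : ℤ) (n : ℕ) (t : ℝ) :
    |slitKernel x n t| ≤ 2 * |tan (slitAngle t)| ^ n := by
  rw [slitKernel, abs_mul, abs_pow, abs_div, abs_of_pos (cos_slitAngle_pos t), div_eq_mul_inv]
  have h0 := cos_slitAngle_pos t
  gcongr
  calc |cos ((2 * x + 1) * slitAngle t - x * (π / 2))| * (cos (slitAngle t))⁻¹ ≤ 1 * 2 :=
        mul_le_mul (abs_cos_le_one _) (inv_cos_slitAngle_le t) (by positivity) zero_le_one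
    _ = 2 := one_mul 2

theorem ae_abs_tan_slitAngle_lt_one :
    ∀ᵐ t : ℝ, t ∈ uIoc (-(π / 2)) (π / 2) → |tan (slitAngle t)| < 1 := by
  filter_upwards [compl_mem_ae_iff.2 (measure_singleton (μ := volume) (π / 2))] with t ht hmem
  rw [uIoc_of_le (by linarith [pi_pos])] at hmem
  exact abs_tan_slitAngle_lt_one
    (cos_pos_of_mem_Ioo ⟨hmem.1, lt_of_le_of_ne hmem.2 ht⟩)

theorem tendsto_integral_tan_slitAngle_pow :
    Tendsto (fun n : ℕ => ∫ t in -(π / 2)..(π / 2), 2 * |tan (slitAngle t)| ^ n)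
      atTop (𝓝 0) := by
  have h := intervalIntegral.tendsto_integral_filter_of_dominated_convergence
    (μ := volume) (a := -(π / 2)) (b := π / 2) (l := atTop) (f := fun _ => (0 : ℝ))
    (F := fun n : ℕ => fun t => 2 * |tan (slitAngle t)| ^ n) (fun _ => 2)
    (Eventually.of_forall fun n =>
      (continuous_const.mul (continuous_tan_slitAngle.abs.pow n)).aestronglyMeasurable)
    (Eventually.of_forall fun n => ae_of_all _ fun t _ => by
      rw [Real.norm_eq_abs, abs_of_nonneg (by positivity)]
      linarith [pow_le_one₀ (n := n) (abs_nonneg (tan (slitAngle t)))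
        (abs_tan_slitAngle_le_one t)])
    intervalIntegrable_const
    (by
      filter_upwards [ae_abs_tan_slitAngle_lt_one] with t ht hmem
      simpa using (tendsto_pow_atTop_nhds_zero_of_lt_one (abs_nonneg _) (ht hmem)).const_mul 2)
  simpa using h

theorem abs_slitPotential_le (x : ℤ) (n : ℕ) :
    |slitPotential x n| ≤ ∫ t in -(π / 2)..(π / 2), 2 * |tan (slitAngle t)| ^ n := by
  have hpi : π⁻¹ ≤ 1 := inv_le_one_of_one_le₀ (by linarith [pi_gt_three])
  have h := intervalIntegral.norm_integral_le_of_norm_le (μ := volume)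
    (a := -(π / 2)) (b := π / 2) (f := slitKernel x n) (by linarith [pi_pos])
    (ae_of_all _ fun t _ => abs_slitKernel_le x n t)
    ((continuous_const.mul (continuous_tan_slitAngle.abs.pow n)).intervalIntegrable _ _)
  rw [slitPotential, abs_mul, abs_of_pos (inv_pos.2 pi_pos)]
  calc _ ≤ 1 * |∫ t in -(π / 2)..(π / 2), slitKernel x n t| := by gcongr
    _ ≤ _ := by rw [one_mul]; exact h

theorem injOn_slitAngle : InjOn slitAngle (Ioo (-(π / 2)) (π / 2)) := by
  intro s hs t ht h
  have h1 := sin_slitAngle s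
  rw [h, sin_slitAngle, div_left_inj' (by positivity)] at h1
  exact injOn_sin ⟨hs.1.le, hs.2.le⟩ ⟨ht.1.le, ht.2.le⟩ h1.symm

/-- Riemann-Lebesgue lemma along a fixed row, after the substitution `v = slitAngle t`. -/
theorem tendsto_slitPotential_cofinite (n : ℕ) :
    Tendsto (fun x : ℤ => slitPotential x n) cofinite (𝓝 0) := by
  set E : Set ℝ := Ioo (-(π / 2)) (π / 2)
  have hE : MeasurableSet E := measurableSet_Ioo
  have hval (t : ℝ) (ht : t ∈ E) : 0 < cos t := cos_pos_of_mem_Ioo ht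
  let G : ℝ → ℂ := fun v => ((√2 * tan v ^ n / √(cos (2 * v)) : ℝ) : ℂ)
  let Z : ℝ → ℂ := fun w => ∫ v in slitAngle '' E, Real.fourierChar (-(v * w)) • G v
  have himg : MeasurableSet (slitAngle '' E) :=
    hE.image_of_continuousOn_injOn continuous_slitAngle.continuousOn injOn_slitAngle
  have hZ : Tendsto Z (cocompact ℝ) (𝓝 0) := by
    have h := Real.tendsto_integral_exp_smul_cocompact ((slitAngle '' E).indicator G)
    refine h.congr fun w => ?_
    simp only [Z]
    rw [← integral_indicator himg]
    congr 1
    funext v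
    by_cases hv : v ∈ slitAngle '' E <;> simp [hv]
  have hfreq : Tendsto (fun x : ℤ => -(2 * (x : ℝ) + 1) / (2 * π)) cofinite (cocompact ℝ) := by
    have hemb : Topology.IsClosedEmbedding (fun r : ℝ => -(2 * r + 1) / (2 * π)) := by
      have : (fun r : ℝ => -(2 * r + 1) / (2 * π)) =
          ((Homeomorph.mulRight₀ (-π⁻¹) (by simp [pi_ne_zero])).trans
            (Homeomorph.addRight (-(2 * π)⁻¹))) := by
        funext r
        simp
        field_simp
        ring
      rw [this]
      exact Homeomorph.isClosedEmbedding _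
    exact hemb.tendsto_cocompact.comp Int.tendsto_coe_cofinite
  have hlim := (hZ.comp hfreq).norm
  rw [norm_zero] at hlim
  refine squeeze_zero_norm (fun x => ?_) hlim
  have hZx : Z (-(2 * (x : ℝ) + 1) / (2 * π)) = ∫ t in E,
      Complex.exp (((2 * x + 1) * slitAngle t : ℝ) * Complex.I) *
        ((tan (slitAngle t) ^ n / cos (slitAngle t) : ℝ) : ℂ) := by
    simp only [Z]
    rw [integral_image_eq_integral_abs_deriv_smul hE
      (fun t _ => (hasDerivAt_slitAngle t).hasDerivWithinAt) injOn_slitAngle]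
    refine setIntegral_congr_fun hE fun t ht => ?_
    have hct := hval t ht
    have hc := cos_slitAngle_pos t
    have hphase : 2 * π * -(slitAngle t * (-(2 * (x : ℝ) + 1) / (2 * π))) =
        (2 * x + 1) * slitAngle t := by field_simp
    have hamp : cos t / (√2 * cos (slitAngle t)) *
        (√2 * tan (slitAngle t) ^ n / √(cos (2 * slitAngle t))) =
        tan (slitAngle t) ^ n / cos (slitAngle t) := by
      rw [cos_two_mul_slitAngle, sqrt_sq hct.le]
      field_simp
    simp only [G, Circle.smul_def, Real.fourierChar_apply, hphase, smul_eq_mul]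
    rw [abs_of_pos (by positivity), ← hamp, Complex.real_smul]
    push_cast
    ring
  have hK : ∫ t in -(π / 2)..(π / 2), slitKernel x n t =
      (Complex.exp ((-(x * (π / 2)) : ℝ) * Complex.I) * Z (-(2 * (x : ℝ) + 1) / (2 * π))).re := by
    have hcont : Continuous fun t => Complex.exp ((-(x * (π / 2)) : ℝ) * Complex.I) *
        (Complex.exp (((2 * x + 1) * slitAngle t : ℝ) * Complex.I) *
        ((tan (slitAngle t) ^ n / cos (slitAngle t) : ℝ) : ℂ)) := by
      have h1 := continuous_slitAngle
      have h2 : Continuous fun t => tan (slitAngle t) ^ n / cos (slitAngle t) :=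
        (continuous_tan_slitAngle.pow n).div (continuous_cos.comp continuous_slitAngle)
          fun t => (cos_slitAngle_pos t).ne'
      fun_prop
    rw [intervalIntegral.integral_of_le (by linarith [pi_pos]), integral_Ioc_eq_integral_Ioo,
      hZx, ← integral_const_mul, ← RCLike.re_eq_complex_re, ← integral_re]
    · refine setIntegral_congr_fun hE fun t _ => ?_
      have hphase : (2 * (x : ℝ) + 1) * slitAngle t - x * (π / 2) =
        -(x * (π / 2)) + (2 * x + 1) * slitAngle t := by ring
      simp only [slitKernel, RCLike.re_eq_complex_re]
      rw [← mul_assoc, ← Complex.exp_add, ← add_mul, ← Complex.ofReal_add,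
        Complex.re_mul_ofReal, Complex.exp_ofReal_mul_I_re, hphase]
      ring
    · exact (hcont.integrableOn_Icc (a := -(π / 2)) (b := π / 2)).mono_set Ioo_subset_Icc_self
  have hpi : π⁻¹ ≤ 1 := inv_le_one_of_one_le₀ (by linarith [pi_gt_three])
  rw [slitPotential, hK, norm_mul, Real.norm_eq_abs, abs_of_pos (inv_pos.2 pi_pos),
    Real.norm_eq_abs]
  calc _ ≤ 1 * ‖Complex.exp ((-(x * (π / 2)) : ℝ) * Complex.I) *
        Z (-(2 * (x : ℝ) + 1) / (2 * π))‖ := by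
        gcongr
        exact Complex.abs_re_le_norm _
    _ = ‖Z (-(2 * (x : ℝ) + 1) / (2 * π))‖ := by
        rw [one_mul, norm_mul, Complex.norm_exp_ofReal_mul_I, one_mul]

theorem slitPotential_decay {ε : ℝ} (hε : 0 < ε) :
    ∃ N : ℕ, ∀ (x : ℤ) (n : ℕ), (N : ℤ) ≤ |x| + n → |slitPotential x n| < ε := by
  obtain ⟨N₁, hN₁⟩ := eventually_atTop.1 (tendsto_integral_tan_slitAngle_pow.eventually_lt_const hε)
  have hrow (n : ℕ) : ∃ M : ℕ, ∀ x : ℤ, (M : ℤ) ≤ |x| → |slitPotential x n| < ε := by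
    have h := (tendsto_slitPotential_cofinite n).abs
    rw [abs_zero] at h
    have h' := h.eventually_lt_const hε
    rw [Int.cofinite_eq, eventually_sup, eventually_atBot, eventually_atTop] at h'
    obtain ⟨⟨a, ha⟩, b, hb⟩ := h'
    refine ⟨a.natAbs + b.natAbs, fun x hx => ?_⟩
    rcases abs_cases x with ⟨h1, h2⟩ | ⟨h1, h2⟩
    · exact hb x (by omega)
    · exact ha x (by omega)
  choose M hM using hrow
  refine ⟨N₁ + ∑ n ∈ Finset.range N₁, M n, fun x n h => ?_⟩
  rcases le_or_gt N₁ n with hn | hn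
  · exact (abs_slitPotential_le x n).trans_lt (hN₁ n hn)
  · refine hM n x ?_
    have := Finset.single_le_sum (f := M) (fun _ _ => Nat.zero_le _) (Finset.mem_range.2 hn)
    push_cast at h
    zify at this hn
    linarith

/-- Maximum principle on the half-plane lattice with mixed boundary conditions. -/
theorem slit_maximum_principle (d : ℤ → ℕ → ℝ)
    (hneg : ∀ m : ℤ, m < 0 → d (2 * m) 0 ≤ 0)
    (hpos : ∀ m : ℤ, 0 ≤ m → 2 * d (2 * m) 0 ≤ d (2 * m - 1) 1 + d (2 * m + 1) 1)
    (hharm : ∀ (x : ℤ) (n : ℕ), Even (x + (n + 1)) → 4 * d x (n + 1) ≤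
      d (x - 1) n + d (x + 1) n + d (x - 1) (n + 2) + d (x + 1) (n + 2))
    (hdecay : ∀ ε : ℝ, 0 < ε → ∃ N : ℕ, ∀ (x : ℤ) (n : ℕ), (N : ℤ) ≤ |x| + n → d x n < ε)
    (x : ℤ) (n : ℕ) (hx : Even (x + n)) : d x n ≤ 0 := by
  by_contra! h
  obtain ⟨N, hN⟩ := hdecay _ h
  let S : Finset (ℤ × ℕ) := ((Finset.Icc (-N : ℤ) N) ×ˢ Finset.range (N + 1)).filter
    fun p => Even (p.1 + p.2)
  have hout (p : ℤ × ℕ) (hp : d x n ≤ d p.1 p.2) (he : Even (p.1 + p.2)) : p ∈ S := by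
    have h1 : |p.1| + p.2 < N := not_le.1 fun h1 => (hN _ _ h1).not_ge hp
    have h2 := abs_lt.1 (show |p.1| < N by linarith [p.2.cast_nonneg (α := ℤ)])
    have h3 := abs_nonneg p.1
    simp only [S, Finset.mem_filter, Finset.mem_product, Finset.mem_Icc, Finset.mem_range]
    refine ⟨⟨⟨h2.1.le, h2.2.le⟩, by omega⟩, he⟩
  obtain ⟨p, hpS, hp⟩ := S.exists_max_image
    (fun p => toLex (d p.1 p.2, p.2)) ⟨(x, n), hout _ le_rfl hx⟩
  have hmax (q : ℤ × ℕ) (he : Even (q.1 + q.2)) :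
      d q.1 q.2 < d p.1 p.2 ∨ d q.1 q.2 = d p.1 p.2 ∧ q.2 ≤ p.2 := by
    have hxp : d x n ≤ d p.1 p.2 := by
      have := hp (x, n) (hout _ le_rfl hx)
      rw [Prod.Lex.toLex_le_toLex] at this
      rcases this with h1 | h1
      · exact h1.le
      · exact h1.1.le
    by_cases hq : q ∈ S
    · simpa [Prod.Lex.toLex_le_toLex] using hp q hq
    · exact Or.inl (lt_of_not_ge fun h1 => hq (hout q (hxp.trans h1) he))
  have hle (a : ℤ) (k : ℕ) (he : Even (a + k)) : d a k ≤ d p.1 p.2 := by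
    rcases hmax (a, k) he with h1 | h1
    · exact h1.le
    · exact h1.1.le
  have hlt (a : ℤ) (k : ℕ) (he : Even (a + k)) (hk : p.2 < k) : d a k < d p.1 p.2 :=
    (hmax (a, k) he).resolve_right fun h1 => h1.2.not_gt hk
  have hpe : Even (p.1 + p.2) := (Finset.mem_filter.1 hpS).2
  have hp0 : 0 < d p.1 p.2 := h.trans_le (hle _ _ hx)
  obtain ⟨a, k⟩ := p
  rcases k with _ | k
  · obtain ⟨m, rfl⟩ : ∃ m, a = 2 * m := by
      obtain ⟨m, hm⟩ := hpe
      exact ⟨m, by push_cast at hm; omega⟩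
    rcases lt_or_ge m 0 with hm | hm
    · exact (hneg m hm).not_gt hp0
    · have h1 := hlt (2 * m - 1) 1 ⟨m, by push_cast; ring⟩ Nat.zero_lt_one
      have h2 := hlt (2 * m + 1) 1 ⟨m + 1, by push_cast; ring⟩ Nat.zero_lt_one
      have h3 := hpos m hm
      simp only at h1 h2
      linarith
  · have h0 := hharm a k (by exact_mod_cast hpe)
    push_cast at hpe
    have h1 := hle (a - 1) k (by grind)
    have h2 := hle (a + 1) k (by grind)
    have h3 := hlt (a - 1) (k + 2) (by push_cast; grind) (by simp)
    have h4 := hlt (a + 1) (k + 2) (by push_cast; grind) (by simp)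
    simp only at h1 h2 h3 h4
    linarith

theorem IsSlitGreen.eq_slitPotential {g : ℤ × ℤ → ℝ} (hg : IsSlitGreen g) (x : ℤ) (n : ℕ)
    (hx : Even (x + n)) : g (x, n) = slitPotential x n := by
  obtain ⟨-, hdir, hharm, hneu, hsrc, -, hdec⟩ := hg
  have hsrc' := slitPotential_flux_zero
  have hharm' (x : ℤ) (n : ℕ) (he : Even (x + (n + 1))) : 4 * g (x, (n + 1 : ℕ)) =
      g (x - 1, n) + g (x + 1, n) + g (x - 1, (n + 2 : ℕ)) + g (x + 1, (n + 2 : ℕ)) := by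
    have h := hharm x (n + 1) (by omega) he
    rw [add_sub_cancel_right, add_assoc (n : ℤ) 1 1] at h
    exact_mod_cast h
  have hdec' (ε : ℝ) (hε : 0 < ε) : ∃ N : ℕ, ∀ (x : ℤ) (n : ℕ), (N : ℤ) ≤ |x| + n →
      |g (x, n) - slitPotential x n| < ε := by
    obtain ⟨N₁, h₁⟩ := hdec (ε / 2) (by positivity)
    obtain ⟨N₂, h₂⟩ := slitPotential_decay (ε := ε / 2) (by positivity)
    refine ⟨N₁ + N₂, fun x n h => ?_⟩
    push_cast at h
    have h1 := h₁ x n (by rw [Nat.abs_cast]; omega)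
    have h2 := h₂ x n (by omega)
    exact (abs_sub _ _).trans_lt (by linarith)
  have hflux (m : ℤ) (hm : 0 ≤ m) : 2 * (g (2 * m, 0) - slitPotential (2 * m) 0) =
      (g (2 * m - 1, 1) - slitPotential (2 * m - 1) 1) +
        (g (2 * m + 1, 1) - slitPotential (2 * m + 1) 1) := by
    rcases hm.eq_or_lt with rfl | hm
    · norm_num
      linarith
    · linarith [hneu (2 * m) (by omega) ⟨m, by ring⟩, slitPotential_flux_of_pos hm]
  refine le_antisymm (sub_nonpos.1 ?_) (sub_nonpos.1 ?_)
  · refine slit_maximum_principle (fun x n => g (x, n) - slitPotential x n) ?_ ?_ ?_ ?_ x n hx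
    · intro m hm
      simp [hdir (2 * m) (by omega), slitPotential_row_zero_of_neg hm]
    · intro m hm
      simpa using (hflux m hm).le
    · intro x n he
      linarith [hharm' x n he, slitPotential_harmonic x n]
    · intro ε hε
      obtain ⟨N, hN⟩ := hdec' ε hε
      exact ⟨N, fun x n h => (abs_lt.1 (hN x n h)).2⟩
  · refine slit_maximum_principle (fun x n => slitPotential x n - g (x, n)) ?_ ?_ ?_ ?_ x n hx
    · intro m hm
      simp [hdir (2 * m) (by omega), slitPotential_row_zero_of_neg hm]
    · intro m hm
      have := hflux m hm
      simp only [Nat.cast_zero, Nat.cast_one]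
      linarith
    · intro x n he
      linarith [hharm' x n he, slitPotential_harmonic x n]
    · intro ε hε
      obtain ⟨N, hN⟩ := hdec' ε hε
      exact ⟨N, fun x n h => by linarith [(abs_lt.1 (hN x n h)).1]⟩

theorem integral_inv_one_sub_mul_sin_sq {q : ℝ} (hq : q < 1) :
    ∫ t in -(π / 2)..(π / 2), (1 - q * sin t ^ 2)⁻¹ = π / √(1 - q) := by
  have hr : 0 < √(1 - q) := sqrt_pos.2 (by linarith)
  have hr2 : √(1 - q) ^ 2 = 1 - q := sq_sqrt (by linarith)
  have hden (t : ℝ) : 1 - q * sin t ^ 2 ≠ 0 := by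
    have h1 := sin_sq_le_one t
    have h2 := sq_nonneg (sin t)
    rcases le_or_gt q 0 with h | h <;> nlinarith
  have hcont : Continuous fun t => (1 - q * sin t ^ 2)⁻¹ :=
    (continuous_const.sub (continuous_const.mul (continuous_sin.pow 2))).inv₀ hden
  have hderiv (t : ℝ) (ht : t ∈ Ioo (-(π / 2)) (π / 2)) :
      HasDerivAt (fun t => arctan (√(1 - q) * tan t) / √(1 - q)) (1 - q * sin t ^ 2)⁻¹ t := by
    have hc : cos t ≠ 0 := (cos_pos_of_mem_Ioo ht).ne'
    have h := (((hasDerivAt_tan hc).const_mul √(1 - q)).arctan).div_const √(1 - q)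
    refine h.congr_deriv ?_
    have h1 : 1 + (√(1 - q) * tan t) ^ 2 = (1 - q * sin t ^ 2) / cos t ^ 2 := by
      rw [mul_pow, hr2, tan_eq_sin_div_cos]
      field_simp
      linear_combination sin_sq_add_cos_sq t
    have := hden t
    rw [h1]
    field_simp
  have htop := ((tendsto_arctan_atTop.mono_right nhdsWithin_le_nhds).comp
    (tendsto_tan_pi_div_two.const_mul_atTop hr)).div_const √(1 - q)
  have hbot := ((tendsto_arctan_atBot.mono_right nhdsWithin_le_nhds).comp
    (tendsto_tan_neg_pi_div_two.const_mul_atBot hr)).div_const √(1 - q)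
  rw [intervalIntegral.integral_eq_sub_of_hasDerivAt_of_tendsto (by linarith [pi_pos]) hderiv
    (hcont.intervalIntegrable _ _) hbot htop]
  ring

theorem slitPotential_vertical (k : ℕ) : slitPotential 0 (2 * k) =
    π⁻¹ * ∫ t in -(π / 2)..(π / 2), (sin t ^ 2 / (2 - sin t ^ 2)) ^ k := by
  rw [slitPotential]
  congr 2
  funext t
  rw [← tan_sq_slitAngle, slitKernel, pow_mul]
  have := (cos_slitAngle_pos t).ne'
  simp [this]

/-- Vertical-axis generating function of the slit-plane Green's function:
`∑_{k≥1} g(0,2k)·w^{2k} = w²·(√2/√(1-w²) - 1)/(1+w²)`. -/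
theorem slitGreen_vertical_gf (g : ℤ × ℤ → ℝ) (hg : IsSlitGreen g) :
    ∀ w : ℝ, |w| < 1 →
      HasSum (fun k : ℕ => g (0, 2 * ((k : ℤ) + 1)) * w ^ (2 * (k + 1)))
        (w ^ 2 * (Real.sqrt 2 / Real.sqrt (1 - w ^ 2) - 1) / (1 + w ^ 2)) := by
  intro w hw
  have hw2 : w ^ 2 < 1 := (sq_lt_one_iff_abs_lt_one w).2 hw
  have hw0 : 0 ≤ w ^ 2 := sq_nonneg w
  let B : ℝ → ℝ := fun t => sin t ^ 2 / (2 - sin t ^ 2)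
  have hden (t : ℝ) : 0 < 2 - sin t ^ 2 := by linarith [sin_sq_le_one t]
  have hB0 (t : ℝ) : 0 ≤ B t := div_nonneg (sq_nonneg _) (hden t).le
  have hB1 (t : ℝ) : B t ≤ 1 := by
    rw [div_le_one (hden t)]
    linarith [sin_sq_le_one t]
  have hBc : Continuous B := (continuous_sin.pow 2).div
    (continuous_const.sub (continuous_sin.pow 2)) fun t => (hden t).ne'
  have hterm (k : ℕ) : g (0, 2 * ((k : ℤ) + 1)) * w ^ (2 * (k + 1)) =
      π⁻¹ * ∫ t in -(π / 2)..(π / 2), (B t * w ^ 2) ^ (k + 1) := by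
    have h := hg.eq_slitPotential 0 (2 * (k + 1)) (by simp)
    push_cast at h
    rw [h, slitPotential_vertical, pow_mul, mul_assoc, ← intervalIntegral.integral_mul_const]
    simp only [mul_pow, B]
  have hgeom : Summable fun k : ℕ => (w ^ 2) ^ (k + 1) :=
    (summable_nat_add_iff 1).2 (summable_geometric_of_lt_one hw0 hw2)
  have hsum := intervalIntegral.hasSum_integral_of_dominated_convergence (μ := volume)
    (a := -(π / 2)) (b := π / 2) (F := fun (k : ℕ) t => (B t * w ^ 2) ^ (k + 1))
    (f := fun t => B t * w ^ 2 * (1 - B t * w ^ 2)⁻¹) (fun k _ => (w ^ 2) ^ (k + 1))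
    (fun k => ((hBc.mul continuous_const).pow _).aestronglyMeasurable)
    (fun k => ae_of_all _ fun t _ => by
      have h0 : 0 ≤ B t * w ^ 2 := mul_nonneg (hB0 t) hw0
      rw [Real.norm_eq_abs, abs_of_nonneg (pow_nonneg h0 _)]
      exact pow_le_pow_left₀ h0 (mul_le_of_le_one_left hw0 (hB1 t)) _)
    (ae_of_all _ fun _ _ => hgeom) intervalIntegrable_const
    (ae_of_all _ fun t _ => by
      have h := (hasSum_geometric_of_lt_one (mul_nonneg (hB0 t) hw0)
        ((mul_le_of_le_one_left hw0 (hB1 t)).trans_lt hw2)).mul_left (B t * w ^ 2)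
      simpa only [← pow_succ'] using h)
  simp only [hterm]
  suffices hval : π⁻¹ * ∫ t in -(π / 2)..(π / 2), B t * w ^ 2 * (1 - B t * w ^ 2)⁻¹ =
      w ^ 2 * (√2 / √(1 - w ^ 2) - 1) / (1 + w ^ 2) from hval ▸ hsum.mul_left π⁻¹
  have hq : (1 + w ^ 2) / 2 < 1 := by linarith
  have hqd (t : ℝ) : 1 - (1 + w ^ 2) / 2 * sin t ^ 2 ≠ 0 := by
    nlinarith [sin_sq_le_one t, sq_nonneg (sin t)]
  have hint (t : ℝ) : B t * w ^ 2 * (1 - B t * w ^ 2)⁻¹ =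
      w ^ 2 / (1 + w ^ 2) * ((1 - (1 + w ^ 2) / 2 * sin t ^ 2)⁻¹ - 1) := by
    have h1 := (hden t).ne'
    have h2 := hqd t
    have h3 : 1 - B t * w ^ 2 = 2 * (1 - (1 + w ^ 2) / 2 * sin t ^ 2) / (2 - sin t ^ 2) := by
      simp only [B]
      field_simp
      ring
    rw [h3]
    simp only [B]
    have h4 : 1 + w ^ 2 ≠ 0 := by positivity
    generalize hD : 1 - (1 + w ^ 2) / 2 * sin t ^ 2 = D at h2 ⊢
    field_simp
    linear_combination (-2 * w ^ 2) * hD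
  have hcont : Continuous fun t => (1 - (1 + w ^ 2) / 2 * sin t ^ 2)⁻¹ :=
    (continuous_const.sub (continuous_const.mul (continuous_sin.pow 2))).inv₀ hqd
  simp only [hint]
  rw [intervalIntegral.integral_const_mul, intervalIntegral.integral_sub
    (hcont.intervalIntegrable _ _) intervalIntegrable_const,
    integral_inv_one_sub_mul_sin_sq hq, intervalIntegral.integral_const]
  have hs : √(1 - (1 + w ^ 2) / 2) = √(1 - w ^ 2) / √2 := by
    rw [← sqrt_div (by linarith)]
    congr 1
    ring
  have h1 : √(1 - w ^ 2) ≠ 0 := (sqrt_pos.2 (by linarith)).ne'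
  have h2 : √2 ≠ 0 := by positivity
  have h3 := pi_ne_zero
  have h4 : 1 + w ^ 2 ≠ 0 := by positivity
  rw [hs, smul_eq_mul]
  field_simp
  ring
end

section
/- Every value of the slit-plane Green's function lies in the ring of dyadic rationals with √2 adjoined: for every (x,y) there exist integers a, b and an integer m ≥ 0 with g(x,y) = (a + b·√2)/2^m. -/
section

open Filter Topology PowerSeries

/-- The ring of dyadic rationals with `√2` adjoined. -/
noncomputable def dyadicSqrtTwo : Subring ℝ where
  carrier := {x | ∃ (a b : ℤ) (m : ℕ), x = (a + b * √2) / 2 ^ m}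
  mul_mem' := by
    rintro _ _ ⟨a, b, m, rfl⟩ ⟨c, d, n, rfl⟩
    refine ⟨a * c + 2 * b * d, a * d + b * c, m + n, ?_⟩
    have h : √2 * √2 = 2 := Real.mul_self_sqrt zero_le_two
    push_cast
    rw [pow_add, div_mul_div_comm]
    congr 1
    linear_combination (b * d : ℝ) * h
  one_mem' := ⟨1, 0, 0, by simp⟩
  add_mem' := by
    rintro _ _ ⟨a, b, m, rfl⟩ ⟨c, d, n, rfl⟩
    refine ⟨a * 2 ^ n + c * 2 ^ m, b * 2 ^ n + d * 2 ^ m, m + n, ?_⟩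
    push_cast
    rw [pow_add]
    field_simp
    ring
  zero_mem' := ⟨0, 0, 0, by simp⟩
  neg_mem' := by
    rintro _ ⟨a, b, m, rfl⟩
    exact ⟨-a, -b, m, by push_cast; ring⟩

lemma sqrt_two_mem : √2 ∈ dyadicSqrtTwo := ⟨0, 1, 0, by simp⟩

lemma half_mem : (1 / 2 : ℝ) ∈ dyadicSqrtTwo := ⟨1, 0, 1, by simp⟩

/-- The coefficients of `√(1 - X)`. -/
noncomputable def sqrtCoeff : ℕ → ℝ
  | 0 => 1
  | n + 1 => -(1 / 2) * (catalan n * (1 / 2) ^ (2 * n))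

lemma sqrtCoeff_mem (n : ℕ) : sqrtCoeff n ∈ dyadicSqrtTwo := by
  cases n with
  | zero => exact one_mem _
  | succ n =>
    exact mul_mem (neg_mem half_mem) (mul_mem (natCast_mem _ _) (pow_mem half_mem _))

lemma sqrtCoeff_succ_nonpos (n : ℕ) : sqrtCoeff (n + 1) ≤ 0 := by
  have : (0 : ℝ) ≤ 1 / 2 * (catalan n * (1 / 2) ^ (2 * n)) := by positivity
  rw [sqrtCoeff]; linarith

lemma sqrtCoeff_rec (n : ℕ) :
    (2 * n + 2) * sqrtCoeff (n + 1) = (2 * n - 1) * sqrtCoeff n := by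
  cases n with
  | zero => simp [sqrtCoeff]
  | succ n =>
    have h1 := succ_mul_catalan_eq_centralBinom n
    have h2 := succ_mul_catalan_eq_centralBinom (n + 1)
    have h3 := Nat.succ_mul_centralBinom_succ n
    rw [← h1, ← h2] at h3
    have h4 : ((n : ℝ) + 1) * ((n + 1 + 1) * catalan (n + 1)) =
        2 * (2 * n + 1) * ((n + 1) * catalan n) := by exact_mod_cast h3
    have h5 : ((n : ℝ) + 2) * catalan (n + 1) = 2 * (2 * n + 1) * catalan n := by
      have : (n : ℝ) + 1 ≠ 0 := by positivity
      apply mul_left_cancel₀ this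
      linear_combination h4
    simp only [sqrtCoeff]
    push_cast
    rw [show 2 * (n + 1) = 2 * n + 2 by ring, pow_add]
    linear_combination (-(1 / 4) * (1 / 2) ^ (2 * n)) * h5

lemma sum_sqrtCoeff (n : ℕ) :
    ∑ i ∈ Finset.range (n + 1), sqrtCoeff i = -(2 * n + 2) * sqrtCoeff (n + 1) := by
  induction n with
  | zero => simp [sqrtCoeff]
  | succ n ih =>
    rw [Finset.sum_range_succ, ih]
    have := sqrtCoeff_rec (n + 1)
    push_cast at this ⊢
    linear_combination this

lemma sum_sqrtCoeff_nonneg (n : ℕ) : 0 ≤ ∑ i ∈ Finset.range n, sqrtCoeff i := by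
  cases n with
  | zero => simp
  | succ n =>
    rw [sum_sqrtCoeff]
    nlinarith [sqrtCoeff_succ_nonpos n, (Nat.cast_nonneg n : (0 : ℝ) ≤ n)]

/-- The power series `√(1 - X)`. -/
noncomputable def sqrtSeries : ℝ⟦X⟧ := mk sqrtCoeff

/-- The power series `1 - √(1 - X)`. -/
noncomputable def oneSubSqrtSeries : ℝ⟦X⟧ := 1 - sqrtSeries

lemma coeff_oneSubSqrtSeries_succ (n : ℕ) :
    coeff (n + 1) oneSubSqrtSeries = -sqrtCoeff (n + 1) := by
  simp [oneSubSqrtSeries, sqrtSeries, coeff_one]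

lemma coeff_oneSubSqrtSeries_zero : coeff 0 oneSubSqrtSeries = 0 := by
  simp [oneSubSqrtSeries, sqrtSeries, sqrtCoeff]

lemma coeff_oneSubSqrtSeries_nonneg (n : ℕ) : 0 ≤ coeff n oneSubSqrtSeries := by
  cases n with
  | zero => rw [coeff_oneSubSqrtSeries_zero]
  | succ n => rw [coeff_oneSubSqrtSeries_succ]; linarith [sqrtCoeff_succ_nonpos n]

lemma coeff_oneSubSqrtSeries_mem (n : ℕ) : coeff n oneSubSqrtSeries ∈ dyadicSqrtTwo := by
  cases n with
  | zero => rw [coeff_oneSubSqrtSeries_zero]; exact zero_mem _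
  | succ n => rw [coeff_oneSubSqrtSeries_succ]; exact neg_mem (sqrtCoeff_mem _)

lemma sum_coeff_oneSubSqrtSeries_le (n : ℕ) :
    ∑ i ∈ Finset.range n, coeff i oneSubSqrtSeries ≤ 1 := by
  cases n with
  | zero => simp
  | succ n =>
    have h := sum_sqrtCoeff_nonneg (n + 1)
    rw [Finset.sum_range_succ'] at h ⊢
    simp only [coeff_oneSubSqrtSeries_succ, coeff_oneSubSqrtSeries_zero,
      Finset.sum_neg_distrib]
    simp only [sqrtCoeff.eq_1] at h
    linarith

lemma sqrtSeries_sq : sqrtSeries ^ 2 = 1 - X := by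
  set K : ℝ⟦X⟧ := mk fun n ↦ catalan n * (1 / 2) ^ (2 * n) with hK
  have hr : sqrtSeries = 1 - C (1 / 2) * (X * K) := by
    ext n
    cases n with
    | zero => simp [sqrtSeries, sqrtCoeff]
    | succ n =>
      rw [map_sub, coeff_C_mul, coeff_succ_X_mul, hK, sqrtSeries, coeff_mk, coeff_mk, coeff_one]
      simp [sqrtCoeff]
  have hK2 : K = 1 + C (1 / 4) * (X * (K * K)) := by
    ext n
    cases n with
    | zero => simp [hK]
    | succ n =>
      rw [map_add, coeff_C_mul, coeff_succ_X_mul, coeff_mul, hK, coeff_mk, coeff_one,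
        catalan_succ']
      simp only [coeff_mk, if_neg (Nat.succ_ne_zero n), zero_add]
      push_cast
      rw [Finset.sum_mul, Finset.mul_sum]
      refine Finset.sum_congr rfl fun p hp ↦ ?_
      rw [← Finset.HasAntidiagonal.mem_antidiagonal.1 hp, show 2 * (p.1 + p.2 + 1) = 2 * p.1 + 2 * p.2 + 2 by ring,
        pow_add, pow_add]
      ring
  have h2 : (C (1 / 2) : ℝ⟦X⟧) + C (1 / 2) = 1 := by rw [← map_add]; norm_num
  have h4 : (C (1 / 4) : ℝ⟦X⟧) = C (1 / 2) * C (1 / 2) := by rw [← map_mul]; norm_num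
  rw [h4] at hK2
  rw [hr]
  linear_combination (X * K) * (-h2) + (-X) * hK2

/-- The power series `1 / (√2 + √(1 - X))`. -/
noncomputable def invSeries : ℝ⟦X⟧ := (C √2 + sqrtSeries)⁻¹

lemma invSeries_mul : (C √2 + sqrtSeries) * invSeries = 1 := by
  refine PowerSeries.mul_inv_cancel _ ?_
  have : 0 < √2 + 1 := by positivity
  simpa [sqrtSeries, sqrtCoeff] using this.ne'

lemma invSeries_eq :
    invSeries = C (√2 - 1) * (1 + oneSubSqrtSeries * invSeries) := by
  have h : (C (√2 - 1) : ℝ⟦X⟧) * (C √2 + 1) = 1 := by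
    rw [← map_one C, ← map_add, ← map_mul]
    congr 1
    linear_combination Real.mul_self_sqrt zero_le_two
  have h1 := invSeries_mul
  have h2 : sqrtSeries = 1 - oneSubSqrtSeries := by simp [oneSubSqrtSeries]
  rw [h2] at h1
  linear_combination (-invSeries) * h + C (√2 - 1) * h1

lemma coeff_invSeries_mem_nonneg (n : ℕ) :
    coeff n invSeries ∈ dyadicSqrtTwo ∧ 0 ≤ coeff n invSeries := by
  induction n using Nat.strong_induction_on with
  | _ n ih =>
    have hs : 0 ≤ √2 - 1 := by
      have := Real.one_le_sqrt.2 (one_le_two (α := ℝ)); linarith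
    have hterm : ∀ p ∈ Finset.HasAntidiagonal.antidiagonal n,
        coeff p.1 oneSubSqrtSeries * coeff p.2 invSeries ∈ dyadicSqrtTwo ∧
          0 ≤ coeff p.1 oneSubSqrtSeries * coeff p.2 invSeries := by
      rintro ⟨i, j⟩ hp
      rw [Finset.HasAntidiagonal.mem_antidiagonal] at hp
      cases i with
      | zero => rw [coeff_oneSubSqrtSeries_zero, zero_mul]; exact ⟨zero_mem _, le_rfl⟩
      | succ i =>
        obtain ⟨h1, h2⟩ := ih j (by simp only at hp; omega)
        exact ⟨mul_mem (coeff_oneSubSqrtSeries_mem _) h1,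
          mul_nonneg (coeff_oneSubSqrtSeries_nonneg _) h2⟩
    rw [invSeries_eq, coeff_C_mul, map_add, coeff_mul, coeff_one]
    refine ⟨mul_mem (sub_mem sqrt_two_mem (one_mem _)) (add_mem ?_
      (sum_mem fun p hp ↦ (hterm p hp).1)), mul_nonneg hs (add_nonneg ?_
      (Finset.sum_nonneg fun p hp ↦ (hterm p hp).2))⟩
    · split_ifs
      exacts [one_mem _, zero_mem _]
    · split_ifs
      exacts [zero_le_one, le_rfl]

lemma sum_coeff_mul_le {F G : ℝ⟦X⟧} (hF : ∀ n, 0 ≤ coeff n F) (hG : ∀ n, 0 ≤ coeff n G)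
    (N : ℕ) : ∑ n ∈ Finset.range N, coeff n (F * G) ≤
      (∑ n ∈ Finset.range N, coeff n F) * ∑ n ∈ Finset.range N, coeff n G := by
  simp only [coeff_mul, Finset.Nat.sum_antidiagonal_eq_sum_range_succ_mk]
  rw [Finset.sum_range_diag_flip N fun i j ↦ coeff i F * coeff j G, Finset.sum_mul]
  refine Finset.sum_le_sum fun i _ ↦ ?_
  rw [← Finset.mul_sum]
  refine mul_le_mul_of_nonneg_left ?_ (hF i)
  exact Finset.sum_le_sum_of_subset_of_nonneg
    (Finset.range_mono (Nat.sub_le _ _)) fun j _ _ ↦ hG j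

lemma sum_coeff_invSeries_le (N : ℕ) : ∑ n ∈ Finset.range N, coeff n invSeries ≤ 1 := by
  have hq n := (coeff_invSeries_mem_nonneg n).2
  set S := ∑ n ∈ Finset.range N, coeff n invSeries with hS
  have hS0 : 0 ≤ S := Finset.sum_nonneg fun n _ ↦ hq n
  have h1 : S ≤ (√2 - 1) * (1 + S) := by
    have hs : 0 ≤ √2 - 1 := by
      have := Real.one_le_sqrt.2 (one_le_two (α := ℝ)); linarith
    have h2 : S = (√2 - 1) * (∑ n ∈ Finset.range N, coeff n (1 : ℝ⟦X⟧)
        + ∑ n ∈ Finset.range N, coeff n (oneSubSqrtSeries * invSeries)) := by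
      conv_lhs => rw [hS, invSeries_eq]
      simp only [coeff_C_mul, map_add, ← Finset.mul_sum, Finset.sum_add_distrib]
    rw [h2]
    refine mul_le_mul_of_nonneg_left (add_le_add ?_ ?_) hs
    · simp only [coeff_one, Finset.sum_ite_eq', Finset.mem_range]
      split_ifs <;> norm_num
    · refine (sum_coeff_mul_le coeff_oneSubSqrtSeries_nonneg hq N).trans ?_
      rw [← h2]
      exact mul_le_of_le_one_left hS0 (sum_coeff_oneSubSqrtSeries_le N)
  have h3 : √2 * √2 = 2 := Real.mul_self_sqrt zero_le_two
  have h4 : √2 ≤ 3 / 2 := by rw [Real.sqrt_le_left (by norm_num)]; norm_num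
  nlinarith

/-- Absolutely summable power series with coefficients in `dyadicSqrtTwo`. -/
noncomputable def summableSeries : Subring ℝ⟦X⟧ where
  carrier := {F | (∀ n, coeff n F ∈ dyadicSqrtTwo) ∧ Summable fun n ↦ ‖coeff n F‖}
  mul_mem' := by
    rintro F G ⟨hF, hF'⟩ ⟨hG, hG'⟩
    refine ⟨fun n ↦ ?_, ?_⟩
    · rw [coeff_mul]
      exact sum_mem fun p _ ↦ mul_mem (hF p.1) (hG p.2)
    · simp only [coeff_mul]
      exact summable_norm_sum_mul_antidiagonal_of_summable_norm
        (f := fun n ↦ coeff n F) (g := fun n ↦ coeff n G) hF' hG'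
  one_mem' := by
    refine ⟨fun n ↦ ?_, summable_of_hasFiniteSupport ((Set.finite_singleton 0).subset fun n hn ↦ ?_)⟩
    · rw [coeff_one]; split_ifs; exacts [one_mem _, zero_mem _]
    · by_contra h
      exact hn (by beta_reduce; rw [coeff_one, if_neg (by simpa using h), norm_zero])
  add_mem' := by
    rintro F G ⟨hF, hF'⟩ ⟨hG, hG'⟩
    refine ⟨fun n ↦ by rw [map_add]; exact add_mem (hF n) (hG n), ?_⟩
    refine (hF'.add hG').of_nonneg_of_le (fun _ ↦ norm_nonneg _) fun n ↦ ?_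
    rw [map_add]; exact norm_add_le _ _
  zero_mem' := ⟨fun n ↦ by rw [map_zero]; exact zero_mem _,
    by simp only [map_zero, norm_zero, summable_zero]⟩
  neg_mem' := by
    rintro F ⟨hF, hF'⟩
    exact ⟨fun n ↦ by rw [map_neg]; exact neg_mem (hF n), by simpa using hF'⟩

lemma C_mem_summableSeries {a : ℝ} (ha : a ∈ dyadicSqrtTwo) : C a ∈ summableSeries := by
  refine ⟨fun n ↦ ?_, summable_of_hasFiniteSupport ((Set.finite_singleton 0).subset fun n hn ↦ ?_)⟩
  · rw [coeff_C]; split_ifs; exacts [ha, zero_mem _]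
  · by_contra h
    exact hn (by beta_reduce; rw [coeff_C, if_neg (by simpa using h), norm_zero])

lemma sqrtSeries_mem_summableSeries : sqrtSeries ∈ summableSeries := by
  have h : oneSubSqrtSeries ∈ summableSeries := by
    refine ⟨coeff_oneSubSqrtSeries_mem, ?_⟩
    simp only [Real.norm_of_nonneg (coeff_oneSubSqrtSeries_nonneg _)]
    exact summable_of_sum_range_le coeff_oneSubSqrtSeries_nonneg sum_coeff_oneSubSqrtSeries_le
  simpa [oneSubSqrtSeries] using sub_mem (one_mem _) h

lemma invSeries_mem_summableSeries : invSeries ∈ summableSeries := by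
  have h n := (coeff_invSeries_mem_nonneg n).2
  refine ⟨fun n ↦ (coeff_invSeries_mem_nonneg n).1, ?_⟩
  simp only [Real.norm_of_nonneg (h _)]
  exact summable_of_sum_range_le h sum_coeff_invSeries_le

/-- The ring of power series generated over `dyadicSqrtTwo` by `√(1 - X)` and
`1 / (√2 + √(1 - X))`. -/
noncomputable def rowSeries : Subring ℝ⟦X⟧ :=
  Subring.closure ({F | ∃ a ∈ dyadicSqrtTwo, F = C a} ∪ {sqrtSeries, invSeries})

lemma C_mem_rowSeries {a : ℝ} (ha : a ∈ dyadicSqrtTwo) : C a ∈ rowSeries :=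
  Subring.subset_closure (Or.inl ⟨a, ha, rfl⟩)

lemma sqrtSeries_mem_rowSeries : sqrtSeries ∈ rowSeries :=
  Subring.subset_closure (Or.inr (Or.inl rfl))

lemma invSeries_mem_rowSeries : invSeries ∈ rowSeries :=
  Subring.subset_closure (Or.inr (Or.inr rfl))

lemma X_mem_rowSeries : (X : ℝ⟦X⟧) ∈ rowSeries := by
  have h := sub_mem (one_mem rowSeries) (pow_mem sqrtSeries_mem_rowSeries 2)
  rwa [sqrtSeries_sq, sub_sub_cancel] at h

lemma rowSeries_le_summableSeries : rowSeries ≤ summableSeries := by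
  refine Subring.closure_le.2 ?_
  rintro F (⟨a, ha, rfl⟩ | rfl | rfl)
  exacts [C_mem_summableSeries ha, sqrtSeries_mem_summableSeries, invSeries_mem_summableSeries]

lemma coeff_mem_of_mem_rowSeries {F : ℝ⟦X⟧} (hF : F ∈ rowSeries) (n : ℕ) :
    coeff n F ∈ dyadicSqrtTwo :=
  (rowSeries_le_summableSeries hF).1 n

lemma tendsto_coeff_of_mem_rowSeries {F : ℝ⟦X⟧} (hF : F ∈ rowSeries) :
    Tendsto (fun n ↦ coeff n F) atTop (𝓝 0) :=
  (rowSeries_le_summableSeries hF).2.of_norm.tendsto_atTop_zero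

/-- Division by `X + 1` with a constant remainder. -/
lemma exists_eq_C_add_mul {F : ℝ⟦X⟧} (hF : F ∈ rowSeries) :
    ∃ c ∈ dyadicSqrtTwo, ∃ D ∈ rowSeries, F = C c + (X + 1) * D := by
  have h1 := invSeries_mul
  have hr := sqrtSeries_sq
  have h2 : (C √2 : ℝ⟦X⟧) * C √2 = 2 := by
    rw [← map_mul, Real.mul_self_sqrt zero_le_two, map_ofNat]
  induction hF using Subring.closure_induction with
  | mem F hF =>
    rcases hF with ⟨a, ha, rfl⟩ | rfl | rfl
    · exact ⟨a, ha, 0, zero_mem _, by simp⟩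
    · refine ⟨√2, sqrt_two_mem, -invSeries, neg_mem invSeries_mem_rowSeries, ?_⟩
      linear_combination (C √2 - sqrtSeries) * h1 - invSeries * h2 + invSeries * hr
    · have hc : √2 * (1 / 2) * (1 / 2) ∈ dyadicSqrtTwo :=
        mul_mem (mul_mem sqrt_two_mem half_mem) half_mem
      refine ⟨_, hc, C (√2 * (1 / 2) * (1 / 2)) * invSeries ^ 2,
        mul_mem (C_mem_rowSeries hc) (pow_mem invSeries_mem_rowSeries _), ?_⟩
      have h3 : (C (√2 * (1 / 2) * (1 / 2)) : ℝ⟦X⟧) * (2 * C √2) = 1 := by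
        rw [← map_ofNat C, ← map_mul, ← map_mul, ← map_one C]
        congr 1
        linear_combination (1 / 2 : ℝ) * Real.mul_self_sqrt zero_le_two
      linear_combination (-invSeries) * h3 + (C (√2 * (1 / 2) * (1 / 2)) *
        (1 - invSeries * (C √2 - sqrtSeries))) * h1 + C (√2 * (1 / 2) * (1 / 2)) *
        invSeries ^ 2 * (h2 - hr)
  | zero => exact ⟨0, zero_mem _, 0, zero_mem _, by simp⟩
  | one => exact ⟨1, one_mem _, 0, zero_mem _, by simp⟩
  | add F G _ _ hF hG =>
    obtain ⟨c, hc, D, hD, h⟩ := hF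
    obtain ⟨d, hd, E, hE, h'⟩ := hG
    refine ⟨c + d, add_mem hc hd, D + E, add_mem hD hE, ?_⟩
    rw [h, h', map_add]; ring
  | neg F _ hF =>
    obtain ⟨c, hc, D, hD, h⟩ := hF
    refine ⟨-c, neg_mem hc, -D, neg_mem hD, ?_⟩
    rw [h, map_neg]; ring
  | mul F G hF' _ hF hG =>
    obtain ⟨c, hc, D, hD, h⟩ := hF
    obtain ⟨d, hd, E, hE, h'⟩ := hG
    refine ⟨c * d, mul_mem hc hd, F * E + C d * D,
      add_mem (mul_mem hF' hE) (mul_mem (C_mem_rowSeries hd) hD), ?_⟩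
    rw [h', map_mul]
    linear_combination C d * h

lemma exists_coeff_add_coeff_succ {F : ℝ⟦X⟧} (hF : F ∈ rowSeries) :
    ∃ D ∈ rowSeries, ∀ n, coeff n D + coeff (n + 1) D = coeff n F := by
  obtain ⟨c, _, D, hD, h⟩ := exists_eq_C_add_mul (mul_mem X_mem_rowSeries hF)
  refine ⟨D, hD, fun n ↦ ?_⟩
  rw [← coeff_succ_X_mul n F, h, map_add, coeff_C, if_neg (Nat.succ_ne_zero n), add_mul, one_mul,
    map_add, coeff_succ_X_mul, zero_add]

lemma eventually_eq_zero_of_add_succ {b : ℕ → ℝ} (hb : Tendsto b atTop (𝓝 0))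
    (h : ∀ᶠ n in atTop, b n + b (n + 1) = 0) : ∀ᶠ n in atTop, b n = 0 := by
  obtain ⟨N, hN⟩ := eventually_atTop.1 h
  filter_upwards [eventually_ge_atTop N] with n hn
  have hk (k : ℕ) : |b (n + k)| = |b n| := by
    induction k with
    | zero => rfl
    | succ k ih =>
      rw [← ih, ← add_assoc, eq_neg_of_add_eq_zero_right (hN (n + k) (by omega)), abs_neg]
  have h1 : Tendsto (fun k ↦ |b (n + k)|) atTop (𝓝 |0|) := by
    have := (hb.comp (tendsto_add_atTop_nat n)).abs
    simpa [Function.comp_def, add_comm] using this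
  simp only [hk, abs_zero] at h1
  exact abs_eq_zero.1 (tendsto_nhds_unique tendsto_const_nhds h1)

lemma exists_rowSeries_of_add_succ {F : ℝ⟦X⟧} (hF : F ∈ rowSeries) {b : ℕ → ℝ}
    (hb : Tendsto b atTop (𝓝 0)) (h : ∀ᶠ n in atTop, b n + b (n + 1) = coeff n F) :
    ∃ D ∈ rowSeries, ∀ᶠ n in atTop, b n = coeff n D := by
  obtain ⟨D, hD, hDF⟩ := exists_coeff_add_coeff_succ hF
  refine ⟨D, hD, ?_⟩
  have h0 := eventually_eq_zero_of_add_succ (b := fun n ↦ b n - coeff n D)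
    (by simpa using hb.sub (tendsto_coeff_of_mem_rowSeries hD))
    (h.mono fun n hn ↦ by rw [← hDF n] at hn; linarith)
  exact h0.mono fun n hn ↦ sub_eq_zero.1 hn

end

open Real MeasureTheory intervalIntegral Filter Topology

/-- The singular weight `(2 sin θ)^(-1/2)` on `[0, π]`. -/
noncomputable def invSqrtSin (θ : ℝ) : ℝ := (√(2 * sin θ))⁻¹

lemma sqrt_two_mul_sin {θ : ℝ} (h : 0 < sin θ) :
    √(2 * sin θ) = 2 * sin θ * invSqrtSin θ := by
  have h2 : 0 < √(2 * sin θ) := sqrt_pos.2 (by positivity)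
  rw [invSqrtSin, ← div_eq_mul_inv, eq_div_iff h2.ne', mul_self_sqrt (by positivity)]

lemma sin_eq_one_sub_two_mul_sq (θ : ℝ) : sin θ = 1 - 2 * sin (θ / 2 - π / 4) ^ 2 := by
  have h := cos_two_mul (θ / 2 - π / 4)
  rw [show 2 * (θ / 2 - π / 4) = θ - π / 2 by ring, cos_sub_pi_div_two] at h
  rw [h, cos_sq']; ring

lemma cos_eq_neg_two_mul (θ : ℝ) :
    cos θ = -(2 * sin (θ / 2 - π / 4) * cos (θ / 2 - π / 4)) := by
  rw [← sin_two_mul, show 2 * (θ / 2 - π / 4) = θ - π / 2 by ring, sin_sub_pi_div_two]; ring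

lemma hasDerivAt_half_sub (θ : ℝ) : HasDerivAt (fun t : ℝ ↦ t / 2 - π / 4) (1 / 2) θ := by
  simpa using ((hasDerivAt_id θ).div_const 2).sub_const (π / 4)

lemma hasDerivAt_sqrt_two_mul_sin {θ : ℝ} (h : 0 < sin θ) :
    HasDerivAt (fun t ↦ √(2 * sin t)) (cos θ * invSqrtSin θ) θ := by
  refine (((hasDerivAt_sin θ).const_mul 2).sqrt (by positivity)).congr_deriv ?_
  rw [invSqrtSin]; field_simp

lemma hasDerivAt_arcsin_half {θ : ℝ} (h : 0 < sin θ) :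
    HasDerivAt (fun t ↦ arcsin (√2 * sin (t / 2 - π / 4)))
      (cos (θ / 2 - π / 4) * invSqrtSin θ) θ := by
  have hs := sin_eq_one_sub_two_mul_sq θ
  have hsq : (√2 * sin (θ / 2 - π / 4)) ^ 2 < 1 := by
    rw [mul_pow, sq_sqrt zero_le_two]; linarith
  have hlt := abs_lt.1 ((sq_lt_one_iff_abs_lt_one _).1 hsq)
  have h1 := (hasDerivAt_arcsin hlt.1.ne' hlt.2.ne).comp θ
    (((hasDerivAt_sin (θ / 2 - π / 4)).comp θ (hasDerivAt_half_sub θ)).const_mul √2)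
  refine h1.congr_deriv ?_
  rw [mul_pow, sq_sqrt zero_le_two, ← hs, invSqrtSin, sqrt_mul zero_le_two]
  have : √(sin θ) ≠ 0 := (sqrt_pos.2 h).ne'
  field_simp
  rw [sq_sqrt zero_le_two]

lemma cos_half_sub_ge {θ : ℝ} (h0 : 0 < θ) (h1 : θ < π) : 1 / 2 ≤ cos (θ / 2 - π / 4) := by
  rw [← cos_pi_div_three, ← cos_abs (θ / 2 - π / 4)]
  apply cos_le_cos_of_nonneg_of_le_pi (abs_nonneg _)
  · linarith
  · rw [abs_le]; constructor <;> linarith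

lemma intervalIntegrable_cos_half :
    IntervalIntegrable (fun θ ↦ cos (θ / 2 - π / 4) * invSqrtSin θ) volume 0 π := by
  apply intervalIntegrable_deriv_of_nonneg
    (g := fun t ↦ arcsin (√2 * sin (t / 2 - π / 4)))
  · exact (by fun_prop : Continuous _).continuousOn
  · intro θ hθ
    rw [min_eq_left pi_pos.le, max_eq_right pi_pos.le] at hθ
    exact hasDerivAt_arcsin_half (sin_pos_of_pos_of_lt_pi hθ.1 hθ.2)
  · intro θ hθ
    rw [min_eq_left pi_pos.le, max_eq_right pi_pos.le] at hθ
    have := cos_half_sub_ge hθ.1 hθ.2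
    exact mul_nonneg (by linarith) (inv_nonneg.2 (sqrt_nonneg _))

lemma integral_cos_half : ∫ θ in (0 : ℝ)..π, cos (θ / 2 - π / 4) * invSqrtSin θ = π := by
  rw [integral_eq_sub_of_hasDerivAt_of_le pi_pos.le
    (f := fun t ↦ arcsin (√2 * sin (t / 2 - π / 4)))
    (by fun_prop : Continuous _).continuousOn
    (fun θ hθ ↦ hasDerivAt_arcsin_half (sin_pos_of_pos_of_lt_pi hθ.1 hθ.2))
    intervalIntegrable_cos_half]
  rw [show π / 2 - π / 4 = π / 4 by ring, show (0 : ℝ) / 2 - π / 4 = -(π / 4) by ring, sin_neg,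
    sin_pi_div_four]
  have : √2 * (√2 / 2) = 1 := by
    rw [← mul_div_assoc, mul_self_sqrt zero_le_two]; norm_num
  rw [mul_neg, this, arcsin_neg, arcsin_one]; ring

lemma intervalIntegrable_invSqrtSin : IntervalIntegrable invSqrtSin volume 0 π := by
  refine (intervalIntegrable_cos_half.const_mul 2).mono_fun ?_ ?_
  · unfold invSqrtSin
    exact (by fun_prop : Measurable fun θ : ℝ ↦ (√(2 * sin θ))⁻¹).aestronglyMeasurable
  · rw [Set.uIoc_of_le pi_pos.le, ← restrict_Ioo_eq_restrict_Ioc]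
    filter_upwards [ae_restrict_mem measurableSet_Ioo] with θ hθ
    have h1 := cos_half_sub_ge hθ.1 hθ.2
    have h2 : 0 ≤ invSqrtSin θ := inv_nonneg.2 (sqrt_nonneg _)
    rw [norm_of_nonneg h2, norm_of_nonneg (by positivity)]
    nlinarith

lemma intervalIntegrable_mul_invSqrtSin {f : ℝ → ℝ} (hf : ContinuousOn f (Set.Icc 0 π)) :
    IntervalIntegrable (fun θ ↦ f θ * invSqrtSin θ) volume 0 π :=
  intervalIntegrable_invSqrtSin.continuousOn_mul (by rwa [Set.uIcc_of_le pi_pos.le])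

lemma integral_mul_invSqrtSin_eq_zero {F f : ℝ → ℝ} (hF : Continuous F) (hf : Continuous f)
    (h0 : F 0 = F π)
    (h : ∀ θ, 0 < sin θ → HasDerivAt F (f θ * invSqrtSin θ) θ) :
    ∫ θ in (0 : ℝ)..π, f θ * invSqrtSin θ = 0 := by
  rw [integral_eq_sub_of_hasDerivAt_of_le pi_pos.le hF.continuousOn
    (fun θ hθ ↦ h θ (sin_pos_of_pos_of_lt_pi hθ.1 hθ.2))
    (intervalIntegrable_mul_invSqrtSin hf.continuousOn), h0, sub_self]

lemma integral_cos_half_mul_sin :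
    ∫ θ in (0 : ℝ)..π, cos (θ / 2 - π / 4) * (2 * sin θ) * invSqrtSin θ = π := by
  have h := integral_mul_invSqrtSin_eq_zero
    (F := fun t ↦ sin (t / 2 - π / 4) * √(2 * sin t))
    (f := fun θ ↦ cos (θ / 2 - π / 4) * (2 * sin θ) - cos (θ / 2 - π / 4))
    (by fun_prop) (by fun_prop) (by simp) (fun θ hθ ↦ by
      refine (((hasDerivAt_sin (θ / 2 - π / 4)).comp θ (hasDerivAt_half_sub θ)).mul
        (hasDerivAt_sqrt_two_mul_sin hθ)).congr_deriv ?_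
      simp only [Function.comp]
      rw [sqrt_two_mul_sin hθ, cos_eq_neg_two_mul θ, sin_eq_one_sub_two_mul_sq θ]
      ring)
  simp only [sub_mul] at h
  rw [intervalIntegral.integral_sub (intervalIntegrable_mul_invSqrtSin
      (by fun_prop : Continuous fun θ : ℝ ↦ cos (θ / 2 - π / 4) * (2 * sin θ)).continuousOn)
    intervalIntegrable_cos_half, integral_cos_half] at h
  linarith

/-- The phase of the Fourier integrand defining the voltage at abscissa `x`. -/
noncomputable def phase (x θ : ℝ) : ℝ := (x + 1 / 2) * θ - π / 4

lemma phase_add_one (x θ : ℝ) : phase (x + 1) θ = phase x θ + θ := by unfold phase; ring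

lemma phase_sub_one (x θ : ℝ) : phase (x - 1) θ = phase x θ - θ := by unfold phase; ring

lemma continuous_phase (x : ℝ) : Continuous (phase x) := by unfold phase; fun_prop

lemma hasDerivAt_cos_phase (x θ : ℝ) :
    HasDerivAt (fun t ↦ cos (phase x t)) (-((x + 1 / 2) * sin (phase x θ))) θ := by
  have h1 : HasDerivAt (phase x) (x + 1 / 2) θ := by
    exact (((hasDerivAt_id θ).const_mul (x + 1 / 2)).sub_const (π / 4)).congr_deriv (mul_one _)
  exact ((hasDerivAt_cos (phase x θ)).comp θ h1).congr_deriv (by ring)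

/-- The boundary voltage. -/
noncomputable def axisVoltage (x : ℝ) : ℝ :=
  (1 / π) * ∫ θ in (0 : ℝ)..π, cos (phase x θ) * invSqrtSin θ

/-- The boundary current. -/
noncomputable def axisCurrent (x : ℝ) : ℝ :=
  (1 / π) * ∫ θ in (0 : ℝ)..π, cos (phase x θ) * (2 * sin θ) * invSqrtSin θ

lemma axisVoltage_zero : axisVoltage 0 = 1 := by
  have h : ∀ θ, phase 0 θ = θ / 2 - π / 4 := fun θ ↦ by unfold phase; ring
  simp only [axisVoltage, h, integral_cos_half]
  field_simp

lemma axisCurrent_zero : axisCurrent 0 = 1 := by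
  have h : ∀ θ, phase 0 θ = θ / 2 - π / 4 := fun θ ↦ by unfold phase; ring
  simp only [axisCurrent, h, integral_cos_half_mul_sin]
  field_simp

lemma axisVoltage_rec (x : ℝ) : (x + 1) * axisVoltage (x + 1) = x * axisVoltage (x - 1) := by
  have hc := continuous_phase
  have h := integral_mul_invSqrtSin_eq_zero
    (F := fun t ↦ √(2 * sin t) * cos (phase x t))
    (f := fun θ ↦ (x + 1) * cos (phase (x + 1) θ) - x * cos (phase (x - 1) θ))
    (by fun_prop) (by fun_prop) (by simp) (fun θ hθ ↦ by
      refine ((hasDerivAt_sqrt_two_mul_sin hθ).mul (hasDerivAt_cos_phase x θ)).congr_deriv ?_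
      rw [sqrt_two_mul_sin hθ, phase_add_one, phase_sub_one, cos_add, cos_sub]
      ring)
  simp only [sub_mul, mul_assoc] at h
  rw [intervalIntegral.integral_sub, intervalIntegral.integral_const_mul,
    intervalIntegral.integral_const_mul] at h
  · simp only [axisVoltage]
    linear_combination (1 / π) * h
  all_goals
    exact (intervalIntegrable_mul_invSqrtSin
      (by fun_prop : Continuous _).continuousOn).const_mul _

lemma axisCurrent_rec (x : ℝ) :
    (x + 2) * axisCurrent (x + 1) = (x - 1) * axisCurrent (x - 1) := by
  have hc := continuous_phase
  have h := integral_mul_invSqrtSin_eq_zero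
    (F := fun t ↦ 2 * sin t * (√(2 * sin t) * cos (phase x t)))
    (f := fun θ ↦ (x + 2) * (cos (phase (x + 1) θ) * (2 * sin θ))
      - (x - 1) * (cos (phase (x - 1) θ) * (2 * sin θ)))
    (by fun_prop) (by fun_prop) (by simp) (fun θ hθ ↦ by
      refine (((hasDerivAt_sin θ).const_mul 2).mul
        ((hasDerivAt_sqrt_two_mul_sin hθ).mul (hasDerivAt_cos_phase x θ))).congr_deriv ?_
      simp only [Pi.mul_apply]
      rw [sqrt_two_mul_sin hθ, phase_add_one, phase_sub_one, cos_add, cos_sub]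
      ring)
  simp only [sub_mul _ _ (invSqrtSin _), mul_assoc] at h
  rw [intervalIntegral.integral_sub, intervalIntegral.integral_const_mul,
    intervalIntegral.integral_const_mul] at h
  · simp only [axisCurrent, mul_assoc]
    linear_combination (1 / π) * h
  all_goals
    simp only [← mul_assoc _ _ (invSqrtSin _)]
    refine intervalIntegrable_mul_invSqrtSin (Continuous.continuousOn ?_)
    fun_prop

/-- The Fourier multiplier carrying a row of a decaying harmonic function to the next row. -/
noncomputable def rowRatio (θ : ℝ) : ℝ := cos θ / (1 + sin θ)

lemma one_add_sin_pos {θ : ℝ} (hθ : θ ∈ Set.Icc 0 π) : 0 < 1 + sin θ := by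
  have := sin_nonneg_of_mem_Icc hθ
  linarith

lemma continuousOn_rowRatio : ContinuousOn rowRatio (Set.Icc 0 π) :=
  continuous_cos.continuousOn.div (by fun_prop) fun _ hθ ↦ (one_add_sin_pos hθ).ne'

lemma rowRatio_sq {θ : ℝ} (hθ : θ ∈ Set.Icc 0 π) :
    4 * rowRatio θ = 2 * cos θ * (1 + rowRatio θ ^ 2) := by
  have h := (one_add_sin_pos hθ).ne'
  rw [rowRatio]
  field_simp
  linear_combination (2 * cos θ) * (-sin_sq_add_cos_sq θ)

lemma cos_mul_rowRatio {θ : ℝ} (hθ : θ ∈ Set.Icc 0 π) : cos θ * rowRatio θ = 1 - sin θ := by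
  have h := (one_add_sin_pos hθ).ne'
  rw [rowRatio]
  field_simp
  linear_combination sin_sq_add_cos_sq θ

/-- The explicit voltage at abscissa `x` in row `n`. -/
noncomputable def voltage (x : ℝ) (n : ℕ) : ℝ :=
  (1 / π) * ∫ θ in (0 : ℝ)..π, cos (phase x θ) * rowRatio θ ^ n * invSqrtSin θ

lemma intervalIntegrable_voltage (x : ℝ) (n : ℕ) (f : ℝ → ℝ) (hf : Continuous f) :
    IntervalIntegrable (fun θ ↦ f θ * cos (phase x θ) * rowRatio θ ^ n * invSqrtSin θ)
      volume 0 π :=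
  intervalIntegrable_mul_invSqrtSin
    ((hf.mul (continuous_cos.comp (continuous_phase x))).continuousOn.mul
      (continuousOn_rowRatio.pow n))

lemma voltage_add_voltage (x : ℝ) (n : ℕ) :
    voltage (x - 1) n + voltage (x + 1) n =
      (1 / π) * ∫ θ in (0 : ℝ)..π,
        2 * cos θ * cos (phase x θ) * rowRatio θ ^ n * invSqrtSin θ := by
  have h (z : ℝ) := intervalIntegrable_voltage z n (fun _ ↦ 1) continuous_const
  simp only [one_mul] at h
  rw [voltage, voltage, ← mul_add, ← intervalIntegral.integral_add (h _) (h _)]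
  congr 2
  ext θ
  rw [phase_add_one, phase_sub_one, cos_add, cos_sub]
  ring

lemma voltage_harmonic (x : ℝ) (n : ℕ) :
    4 * voltage x (n + 1) =
      voltage (x - 1) n + voltage (x + 1) n + voltage (x - 1) (n + 2)
        + voltage (x + 1) (n + 2) := by
  have h (n : ℕ) := intervalIntegrable_voltage x n (fun θ ↦ 2 * cos θ) (by fun_prop)
  rw [add_assoc (_ + _), voltage_add_voltage, voltage_add_voltage, ← mul_add,
    ← intervalIntegral.integral_add (h _) (h _), voltage, mul_left_comm,
    ← intervalIntegral.integral_const_mul]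
  congr 1
  apply integral_congr
  intro θ hθ
  rw [Set.uIcc_of_le pi_pos.le] at hθ
  dsimp only
  linear_combination (cos (phase x θ) * rowRatio θ ^ n * invSqrtSin θ) * rowRatio_sq hθ

lemma axisVoltage_eq (x : ℝ) : axisVoltage x = voltage x 0 := by
  simp [axisVoltage, voltage]

lemma voltage_current (x : ℝ) :
    2 * voltage x 0 - (voltage (x - 1) 1 + voltage (x + 1) 1) = axisCurrent x := by
  have h (n : ℕ) (f : ℝ → ℝ) (hf : Continuous f) := intervalIntegrable_voltage x n f hf
  rw [voltage_add_voltage, voltage, mul_left_comm, ← intervalIntegral.integral_const_mul,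
    ← mul_sub, ← intervalIntegral.integral_sub (by
      simpa using (h 0 (fun _ ↦ 1) continuous_const).const_mul 2)
      (h 1 (fun θ ↦ 2 * cos θ) (by fun_prop)), axisCurrent]
  congr 1
  apply integral_congr
  intro θ hθ
  rw [Set.uIcc_of_le pi_pos.le] at hθ
  dsimp only
  linear_combination (-2 * cos (phase x θ) * invSqrtSin θ) * cos_mul_rowRatio hθ

lemma abs_rowRatio_lt_one {θ : ℝ} (hθ : 0 < sin θ) : |rowRatio θ| < 1 := by
  rw [rowRatio, abs_div, abs_of_pos (by linarith : 0 < 1 + sin θ), div_lt_one (by linarith)]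
  linarith [abs_cos_le_one θ]

lemma abs_voltage_le (x : ℝ) (n : ℕ) :
    |voltage x n| ≤ (1 / π) * ∫ θ in (0 : ℝ)..π, |rowRatio θ| ^ n * invSqrtSin θ := by
  rw [voltage, abs_mul, abs_of_pos (by positivity : 0 < 1 / π)]
  refine mul_le_mul_of_nonneg_left ?_ (by positivity)
  rw [← norm_eq_abs]
  refine norm_integral_le_of_norm_le pi_pos.le (.of_forall fun θ _ ↦ ?_)
    (intervalIntegrable_mul_invSqrtSin (continuousOn_rowRatio.abs.pow n))
  have h : 0 ≤ invSqrtSin θ := inv_nonneg.2 (sqrt_nonneg _)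
  rw [norm_mul, norm_mul, norm_pow, norm_of_nonneg h, norm_eq_abs, norm_eq_abs]
  refine mul_le_mul_of_nonneg_right ?_ h
  exact mul_le_of_le_one_left (by positivity) (abs_cos_le_one _)

lemma tendsto_voltage_bound :
    Tendsto (fun n : ℕ ↦ (1 / π) * ∫ θ in (0 : ℝ)..π, |rowRatio θ| ^ n * invSqrtSin θ)
      atTop (𝓝 0) := by
  have key : Tendsto (fun n : ℕ ↦ ∫ θ in (0 : ℝ)..π, |rowRatio θ| ^ n * invSqrtSin θ)
      atTop (𝓝 (∫ θ in (0 : ℝ)..π, (fun _ ↦ 0) θ)) := by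
    have hne : ∀ᵐ θ : ℝ, θ ≠ π := by simp [ae_iff]
    have hpos : ∀ θ : ℝ, θ ≠ π → θ ∈ Set.uIoc 0 π → 0 < sin θ := fun θ h1 h2 ↦ by
      rw [Set.uIoc_of_le pi_pos.le] at h2
      exact sin_pos_of_pos_of_lt_pi h2.1 (lt_of_le_of_ne h2.2 h1)
    refine tendsto_integral_filter_of_dominated_convergence invSqrtSin ?_ ?_
      intervalIntegrable_invSqrtSin ?_
    · refine .of_forall fun n ↦ ?_
      have := intervalIntegrable_mul_invSqrtSin (continuousOn_rowRatio.abs.pow n)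
      exact this.aestronglyMeasurable_restrict_uIoc
    · refine .of_forall fun n ↦ hne.mono fun θ h1 h2 ↦ ?_
      have h : 0 ≤ invSqrtSin θ := inv_nonneg.2 (sqrt_nonneg _)
      rw [norm_mul, norm_of_nonneg h, norm_of_nonneg (by positivity)]
      exact mul_le_of_le_one_left h
        (pow_le_one₀ (abs_nonneg _) (abs_rowRatio_lt_one (hpos θ h1 h2)).le)
    · refine hne.mono fun θ h1 h2 ↦ ?_
      simpa using (tendsto_pow_atTop_nhds_zero_of_lt_one (abs_nonneg _)
        (abs_rowRatio_lt_one (hpos θ h1 h2))).mul_const (invSqrtSin θ)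
  simpa using key.const_mul (1 / π)

/-- A form of the Riemann-Lebesgue lemma. -/
lemma tendsto_integral_cos_phase {f : ℝ → ℝ} (hf : IntervalIntegrable f volume 0 π) :
    Tendsto (fun x : ℤ ↦ ∫ θ in (0 : ℝ)..π, cos (phase x θ) * f θ) cofinite (𝓝 0) := by
  set F : ℝ → ℂ := (Set.Ioc 0 π).indicator
    fun θ ↦ Complex.exp ((θ / 2 - π / 4 : ℝ) * Complex.I) * (f θ : ℂ) with hF
  have hw : Tendsto (fun x : ℤ ↦ -(x : ℝ) / (2 * π)) cofinite (cocompact ℝ) := by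
    have h1 : Tendsto (fun x : ℤ ↦ (x : ℝ)) cofinite (cocompact ℝ) :=
      Int.tendsto_coe_cofinite
    have h2 := tendsto_cocompact_mul_right₀ (a := -(1 / (2 * π)))
      (neg_ne_zero.2 (by positivity))
    refine (h2.comp h1).congr fun x ↦ ?_
    simp only [Function.comp]; ring
  have h := ((Real.tendsto_integral_exp_smul_cocompact F).comp hw)
  have h3 := (Complex.continuous_re.tendsto 0).comp h
  refine h3.congr fun x ↦ ?_
  simp only [Function.comp]
  have hInt : IntervalIntegrable (fun θ : ℝ ↦
      Complex.exp ((phase x θ : ℝ) * Complex.I) * (f θ : ℂ)) volume 0 π := by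
    refine IntervalIntegrable.continuousOn_mul
      (f := fun θ ↦ (f θ : ℂ)) ⟨hf.1.ofReal, hf.2.ofReal⟩ ?_
    have := continuous_phase x
    fun_prop
  have h4 : (∫ v : ℝ, Real.fourierChar (-(v * (-(x : ℝ) / (2 * π)))) • F v) =
      ∫ θ in (0 : ℝ)..π, Complex.exp ((phase x θ : ℝ) * Complex.I) * (f θ : ℂ) := by
    rw [integral_of_le pi_pos.le, ← MeasureTheory.integral_indicator measurableSet_Ioc]
    congr 1
    ext v
    rw [hF]
    by_cases hv : v ∈ Set.Ioc 0 π
    · rw [Set.indicator_of_mem hv, Set.indicator_of_mem hv, Circle.smul_def,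
        Real.fourierChar_apply, smul_eq_mul, ← mul_assoc, ← Complex.exp_add]
      congr 2
      rw [phase]
      push_cast
      have : (π : ℂ) ≠ 0 := Complex.ofReal_ne_zero.2 pi_ne_zero
      field_simp
      ring
    · rw [Set.indicator_of_notMem hv, Set.indicator_of_notMem hv, smul_zero]
  rw [h4]
  have h5 := Complex.reCLM.intervalIntegral_comp_comm hInt
  simp only [Complex.reCLM_apply] at h5
  rw [← h5]
  congr 1
  ext θ
  rw [Complex.re_mul_ofReal, Complex.exp_ofReal_mul_I_re]

lemma tendsto_voltage (n : ℕ) : Tendsto (fun x : ℤ ↦ voltage x n) cofinite (𝓝 0) := by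
  have h := (tendsto_integral_cos_phase
    (intervalIntegrable_mul_invSqrtSin (continuousOn_rowRatio.pow n))).const_mul (1 / π)
  simpa only [voltage, mul_assoc, mul_zero, Pi.pow_apply] using h

lemma voltage_decay (ε : ℝ) (hε : 0 < ε) :
    ∃ N : ℕ, ∀ (x : ℤ) (n : ℕ), (N : ℤ) ≤ |x| + n → |voltage x n| < ε := by
  obtain ⟨Y, hY⟩ := (tendsto_voltage_bound.eventually (gt_mem_nhds hε)).exists_forall_of_atTop
  have hX (n : ℕ) : ∃ M : ℕ, ∀ x : ℤ, (M : ℤ) ≤ |x| → |voltage x n| < ε := by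
    have h := (tendsto_voltage n).eventually (Metric.ball_mem_nhds 0 hε)
    simp only [dist_zero_right, norm_eq_abs] at h
    have hfin : {x : ℤ | ¬ |voltage x n| < ε}.Finite := h
    obtain ⟨M, hM⟩ := (hfin.image Int.natAbs).bddAbove
    refine ⟨M + 1, fun x hx ↦ ?_⟩
    by_contra hc
    have := hM (Set.mem_image_of_mem Int.natAbs hc)
    rw [Int.abs_eq_natAbs] at hx
    omega
  choose M hM using hX
  refine ⟨Y + ∑ n ∈ Finset.range Y, M n, fun x n hx ↦ ?_⟩
  rcases le_or_gt Y n with h | h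
  · exact (abs_voltage_le x n).trans_lt (hY n h)
  · refine hM n x ?_
    have := Finset.single_le_sum (f := M) (fun _ _ ↦ Nat.zero_le _) (Finset.mem_range.2 h)
    push_cast at hx
    have h' : (M n : ℤ) ≤ ∑ i ∈ Finset.range Y, (M i : ℤ) := by exact_mod_cast this
    omega

open PowerSeries

lemma axisVoltage_neg (k : ℕ) : axisVoltage (-(2 * (k + 1))) = 0 := by
  induction k with
  | zero =>
    have h := axisVoltage_rec (-1)
    norm_num at h ⊢
    exact h
  | succ k ih =>
    have h := axisVoltage_rec (-(2 * (k + 1)) - 1)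
    rw [sub_add_cancel, ih, mul_zero] at h
    rw [show -(2 * ((k : ℝ) + 1)) - 1 - 1 = -(2 * ((k + 1 : ℕ) + 1)) by push_cast; ring] at h
    refine (mul_eq_zero.1 h.symm).resolve_left ?_
    have : (0 : ℝ) ≤ k := Nat.cast_nonneg k
    linarith

lemma axisVoltage_nonneg_mem (k : ℕ) : axisVoltage (2 * k) ∈ dyadicSqrtTwo := by
  have h : axisVoltage (2 * k) = k.centralBinom * (1 / 2) ^ (2 * k) := by
    induction k with
    | zero => simp [axisVoltage_zero]
    | succ k ih =>
      have h := axisVoltage_rec (2 * k + 1)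
      rw [add_sub_cancel_right, ih] at h
      have h1 : ((k : ℝ) + 1) * (k + 1).centralBinom = 2 * (2 * k + 1) * k.centralBinom := by
        exact_mod_cast Nat.succ_mul_centralBinom_succ k
      have h2 : (2 * k + 1 + 1 : ℝ) ≠ 0 := by positivity
      rw [show (2 * ((k + 1 : ℕ) : ℝ)) = 2 * k + 1 + 1 by push_cast; ring]
      apply mul_left_cancel₀ h2
      rw [h, show 2 * (k + 1) = 2 * k + 2 by ring, pow_add]
      linear_combination (-(1 / 2) * (1 / 2 : ℝ) ^ (2 * k)) * h1
  rw [h]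
  exact mul_mem (natCast_mem _ _) (pow_mem half_mem _)

lemma axisCurrent_pos (k : ℕ) : axisCurrent (2 * (k + 1)) = 0 := by
  induction k with
  | zero =>
    have h := axisCurrent_rec 1
    norm_num at h ⊢
    exact h
  | succ k ih =>
    have h := axisCurrent_rec (2 * (k + 1) + 1)
    rw [add_sub_cancel_right, ih, mul_zero] at h
    rw [show 2 * ((k + 1 : ℕ) + 1 : ℝ) = 2 * (k + 1) + 1 + 1 by push_cast; ring]
    exact (mul_eq_zero.1 h).resolve_left (by positivity)

lemma axisCurrent_neg (k : ℕ) : axisCurrent (-(2 * k)) = sqrtCoeff k := by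
  induction k with
  | zero => simp [axisCurrent_zero, sqrtCoeff]
  | succ k ih =>
    have h := axisCurrent_rec (-(2 * k) - 1)
    rw [sub_add_cancel, ih] at h
    have h1 := sqrtCoeff_rec k
    have h2 : (2 * k + 2 : ℝ) ≠ 0 := by positivity
    rw [show (-(2 * ((k + 1 : ℕ) : ℝ))) = -(2 * k) - 1 - 1 by push_cast; ring]
    apply mul_left_cancel₀ h2
    linear_combination h - h1

lemma axisVoltage_mem (m : ℤ) : axisVoltage (2 * m) ∈ dyadicSqrtTwo := by
  obtain ⟨k, rfl | rfl⟩ := m.eq_nat_or_neg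
  · exact_mod_cast axisVoltage_nonneg_mem k
  · cases k with
    | zero => simpa using axisVoltage_nonneg_mem 0
    | succ k =>
      have h := axisVoltage_neg k
      rw [show -(2 * ((k : ℝ) + 1)) = 2 * ((-((k + 1 : ℕ) : ℤ) : ℤ) : ℝ) by push_cast; ring] at h
      rw [h]
      exact zero_mem _

lemma axisCurrent_mem (m : ℤ) : axisCurrent (2 * m) ∈ dyadicSqrtTwo := by
  obtain ⟨k, rfl | rfl⟩ := m.eq_nat_or_neg
  · cases k with
    | zero => simp [axisCurrent_zero]
    | succ k =>
      have h := axisCurrent_pos k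
      push_cast
      rw [h]
      exact zero_mem _
  · push_cast
    rw [mul_neg, axisCurrent_neg]
    exact sqrtCoeff_mem k

/-- Row `y` of the voltage, enumerated from right to left. -/
noncomputable def rowVoltage (y : ℕ) (m : ℤ) : ℝ := voltage (y - 2 * m) y

lemma rowVoltage_zero (m : ℤ) : rowVoltage 0 m = axisVoltage (2 * (-m : ℤ)) := by
  rw [rowVoltage, axisVoltage_eq]
  congr 1
  push_cast; ring

lemma rowVoltage_one (m : ℤ) : rowVoltage 1 m + rowVoltage 1 (m + 1) =
    2 * axisVoltage (2 * (-m : ℤ)) - axisCurrent (2 * (-m : ℤ)) := by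
  rw [← voltage_current, axisVoltage_eq, rowVoltage, rowVoltage]
  rw [show ((1 : ℕ) : ℝ) - 2 * m = 2 * ((-m : ℤ) : ℝ) + 1 by push_cast; ring,
    show ((1 : ℕ) : ℝ) - 2 * ((m + 1 : ℤ) : ℝ) = 2 * ((-m : ℤ) : ℝ) - 1 by push_cast; ring]
  ring

lemma rowVoltage_add_two (y : ℕ) (m : ℤ) :
    rowVoltage (y + 2) m + rowVoltage (y + 2) (m + 1) =
      4 * rowVoltage (y + 1) m - (rowVoltage y m + rowVoltage y (m - 1)) := by
  have h := voltage_harmonic (y + 1 - 2 * m) y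
  simp only [rowVoltage]
  push_cast
  rw [show (y : ℝ) + 2 - 2 * m = y + 1 - 2 * m + 1 by ring,
    show (y : ℝ) + 2 - 2 * (m + 1) = y + 1 - 2 * m - 1 by ring,
    show (y : ℝ) - 2 * (m - 1) = y + 1 - 2 * m + 1 by ring, h,
    show (y : ℝ) - 2 * m = y + 1 - 2 * m - 1 by ring]
  ring

lemma tendsto_rowVoltage (y : ℕ) : Tendsto (fun n : ℕ ↦ rowVoltage y n) atTop (𝓝 0) := by
  have h : Tendsto (fun n : ℕ ↦ (y - 2 * n : ℤ)) atTop cofinite := by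
    rw [← Nat.cofinite_eq_atTop]
    refine Function.Injective.tendsto_cofinite fun a b hab ↦ ?_
    omega
  refine ((tendsto_voltage y).comp h).congr fun n ↦ ?_
  simp [rowVoltage]

lemma rowVoltage_eventually (y : ℕ) :
    (∃ F ∈ rowSeries, ∀ᶠ n : ℕ in atTop, rowVoltage y n = coeff n F) ∧
      ∃ F ∈ rowSeries, ∀ᶠ n : ℕ in atTop, rowVoltage (y + 1) n = coeff n F := by
  induction y with
  | zero =>
    have h0 : ∀ᶠ n : ℕ in atTop, rowVoltage 0 n = 0 := by
      filter_upwards [eventually_ge_atTop 1] with n hn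
      obtain ⟨k, rfl⟩ := Nat.exists_eq_add_of_le' hn
      rw [rowVoltage_zero, ← axisVoltage_neg k]
      congr 1
      push_cast; ring
    refine ⟨⟨0, zero_mem _, h0.mono fun n hn ↦ by rw [hn, map_zero]⟩, ?_⟩
    refine exists_rowSeries_of_add_succ (neg_mem sqrtSeries_mem_rowSeries)
      (tendsto_rowVoltage 1) ?_
    filter_upwards [h0] with n hn
    have h := rowVoltage_one n
    rw [rowVoltage_zero] at hn
    rw [hn] at h
    push_cast at h ⊢
    rw [h, mul_neg, axisCurrent_neg, map_neg, sqrtSeries, coeff_mk]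
    ring
  | succ y ih =>
    obtain ⟨⟨F, hF, hFy⟩, G, hG, hGy⟩ := ih
    refine ⟨⟨G, hG, hGy⟩, ?_⟩
    have hmem : C 4 * G - (F + X * F) ∈ rowSeries :=
      sub_mem (mul_mem (C_mem_rowSeries (ofNat_mem dyadicSqrtTwo 4)) hG)
        (add_mem hF (mul_mem X_mem_rowSeries hF))
    refine exists_rowSeries_of_add_succ hmem (tendsto_rowVoltage (y + 2)) ?_
    have hFy' : ∀ᶠ n : ℕ in atTop, rowVoltage y (n - 1 : ℤ) = coeff n (X * F) := by
      have h1 := (tendsto_sub_atTop_nat 1).eventually hFy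
      filter_upwards [h1, eventually_ge_atTop 1] with n hn hn1
      obtain ⟨k, rfl⟩ := Nat.exists_eq_add_of_le' hn1
      rw [coeff_succ_X_mul]
      simpa using hn
    filter_upwards [hFy, hGy, hFy'] with n h1 h2 h3
    have h := rowVoltage_add_two y n
    rw [h1, h2, h3] at h
    push_cast
    rw [h, map_sub, map_add, coeff_C_mul]

lemma mem_of_add_succ_mem {b : ℤ → ℝ} (h : ∀ m, b m + b (m + 1) ∈ dyadicSqrtTwo) {N : ℤ}
    (hN : b N ∈ dyadicSqrtTwo) (m : ℤ) : b m ∈ dyadicSqrtTwo := by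
  induction m using Int.inductionOn' (b := N) with
  | zero => exact hN
  | succ k _ ih => simpa using sub_mem (h k) ih
  | pred k _ ih =>
    have := sub_mem (h (k - 1)) (by simpa using ih : b (k - 1 + 1) ∈ dyadicSqrtTwo)
    simpa using this

lemma rowVoltage_mem (y : ℕ) :
    (∀ m, rowVoltage y m ∈ dyadicSqrtTwo) ∧ ∀ m, rowVoltage (y + 1) m ∈ dyadicSqrtTwo := by
  have hrow (z : ℕ) : ∃ N : ℤ, rowVoltage z N ∈ dyadicSqrtTwo := by
    obtain ⟨F, hF, h⟩ := (rowVoltage_eventually z).1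
    obtain ⟨n, hn⟩ := h.exists
    exact ⟨n, hn ▸ coeff_mem_of_mem_rowSeries hF n⟩
  induction y with
  | zero =>
    refine ⟨fun m ↦ by rw [rowVoltage_zero]; exact axisVoltage_mem _, ?_⟩
    obtain ⟨N, hN⟩ := hrow 1
    refine mem_of_add_succ_mem (fun m ↦ ?_) hN
    rw [zero_add, rowVoltage_one]
    exact sub_mem (mul_mem (ofNat_mem _ 2) (axisVoltage_mem _)) (axisCurrent_mem _)
  | succ y ih =>
    refine ⟨ih.2, ?_⟩
    obtain ⟨N, hN⟩ := hrow (y + 2)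
    refine mem_of_add_succ_mem (fun m ↦ ?_) hN
    rw [rowVoltage_add_two]
    exact sub_mem (mul_mem (ofNat_mem _ 4) (ih.2 m)) (add_mem (ih.1 m) (ih.1 _))

lemma voltage_mem {x : ℤ} {y : ℕ} (h : Even (x + y)) : voltage x y ∈ dyadicSqrtTwo := by
  obtain ⟨k, hk⟩ := h
  have hm := (rowVoltage_mem y).1 (y - k)
  have hx : x = 2 * k - y := by omega
  rw [rowVoltage] at hm
  rw [hx]
  push_cast at hm ⊢
  rwa [show (y : ℝ) - 2 * (y - k) = 2 * k - y by ring] at hm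

/-- The maximum principle on the slit half-plane. -/
lemma slit_maximum_principle_s7 {h : ℤ × ℤ → ℝ} (hneg : ∀ x : ℤ, x < 0 → Even x → h (x, 0) ≤ 0)
    (hharm : ∀ x y : ℤ, 1 ≤ y → Even (x + y) → 4 * h (x, y) =
      h (x - 1, y - 1) + h (x + 1, y - 1) + h (x - 1, y + 1) + h (x + 1, y + 1))
    (hrefl : ∀ x : ℤ, 0 ≤ x → Even x → 2 * h (x, 0) = h (x - 1, 1) + h (x + 1, 1))
    (hdecay : ∀ ε : ℝ, 0 < ε → ∃ N : ℕ, ∀ x y : ℤ, 0 ≤ y → (N : ℤ) ≤ |x| + |y| →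
      |h (x, y)| < ε) (x y : ℤ) (hy : 0 ≤ y) (hxy : Even (x + y)) : h (x, y) ≤ 0 := by
  by_contra! hpos
  obtain ⟨N, hN⟩ := hdecay _ hpos
  set S : Set (ℤ × ℤ) := {p | 0 ≤ p.2 ∧ Even (p.1 + p.2) ∧ h (x, y) ≤ h p} with hS
  have hfin : S.Finite := by
    refine ((Set.finite_Icc (-N : ℤ) N).prod (Set.finite_Icc (-N : ℤ) N)).subset ?_
    rintro ⟨u, v⟩ ⟨hv, -, huv⟩
    have : |u| + |v| < N := by
      by_contra! hc
      exact absurd ((le_abs_self _).trans_lt (hN u v hv hc)) (not_lt.2 huv)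
    have h1 := abs_nonneg u
    have h2 := abs_nonneg v
    exact ⟨abs_le.1 (by dsimp only; omega), abs_le.1 (by dsimp only; omega)⟩
  obtain ⟨⟨u, v⟩, ⟨hv, huv, hle⟩, hmax⟩ := hfin.exists_maximalFor h S ⟨(x, y), hy, hxy, le_rfl⟩
  have hmax' (a b : ℤ) (hb : 0 ≤ b) (hab : Even (a + b)) : h (a, b) ≤ h (u, v) := by
    by_cases hc : h (x, y) ≤ h (a, b)
    · exact le_of_not_gt fun hlt ↦ absurd (hmax ⟨hb, hab, hc⟩ hlt.le) (not_le.2 hlt)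
    · linarith
  have hray (k : ℕ) : h (u + k, v + k) = h (u, v) := by
    induction k with
    | zero => simp
    | succ k ih =>
      set a := u + (k : ℤ) with ha
      set b := v + (k : ℤ) with hb
      have hb0 : 0 ≤ b := by omega
      have hab : Even (a + b) := by grind
      have e1 : h (a + 1, b + 1) ≤ h (u, v) := hmax' _ _ (by omega) (by grind)
      have e2 : h (a - 1, b + 1) ≤ h (u, v) := hmax' _ _ (by omega) (by grind)
      have key : h (a + 1, b + 1) = h (u, v) := by
        rcases hb0.eq_or_lt with h0 | h0
        · rw [← h0] at ih e1 e2 hab ⊢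
          rw [add_zero] at hab
          rw [zero_add] at e1 e2 ⊢
          rcases lt_or_ge a 0 with h1 | h1
          · linarith [hneg a h1 hab]
          · linarith [hrefl a h1 hab]
        · have e3 : h (a + 1, b - 1) ≤ h (u, v) := hmax' _ _ (by omega) (by grind)
          have e4 : h (a - 1, b - 1) ≤ h (u, v) := hmax' _ _ (by omega) (by grind)
          linarith [hharm a b h0 hab]
      rw [← key]
      push_cast
      rw [ha, hb, add_assoc, add_assoc]
  set k : ℕ := N + u.natAbs with hk
  have hlt := hN (u + k) (v + k) (by omega) (by
    have h1 := le_abs_self (v + k : ℤ)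
    have h2 := abs_nonneg (u + k : ℤ)
    omega)
  rw [hray k] at hlt
  linarith [le_abs_self (h (u, v))]

lemma IsSlitGreen.eq_voltage {g : ℤ × ℤ → ℝ} (hg : IsSlitGreen g) (x : ℤ) (y : ℕ)
    (hxy : Even (x + y)) : g (x, y) = voltage x y := by
  obtain ⟨-, hneg, hharm, hrefl, hsrc, -, hdecay⟩ := hg
  set G : ℤ × ℤ → ℝ := fun p ↦ voltage p.1 p.2.toNat with hG
  have Gneg (x : ℤ) (hx : x < 0) (he : Even x) : G (x, 0) = 0 := by
    obtain ⟨m, rfl⟩ := he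
    obtain ⟨k, rfl⟩ : ∃ k : ℕ, m = -(k + 1) := ⟨(-m - 1).toNat, by omega⟩
    rw [hG, ← axisVoltage_neg k, axisVoltage_eq]
    dsimp only
    congr 1
    push_cast; ring
  have Gharm (x y : ℤ) (hy : 1 ≤ y) : 4 * G (x, y) =
      G (x - 1, y - 1) + G (x + 1, y - 1) + G (x - 1, y + 1) + G (x + 1, y + 1) := by
    obtain ⟨n, rfl⟩ : ∃ n : ℕ, y = n + 1 := ⟨(y - 1).toNat, by omega⟩
    have := voltage_harmonic x n
    simp only [hG]
    rw [show ((n : ℤ) + 1 + 1).toNat = n + 2 by omega, show ((n : ℤ) + 1).toNat = n + 1 by omega,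
      show ((n : ℤ) + 1 - 1).toNat = n by omega]
    push_cast
    exact this
  have Gcur (x : ℤ) : 2 * G (x, 0) - (G (x - 1, 1) + G (x + 1, 1)) = axisCurrent x := by
    rw [← voltage_current]
    simp [hG]
  have Grefl (x : ℤ) (hx : 0 ≤ x) (he : Even x) :
      2 * g (x, 0) - (g (x - 1, 1) + g (x + 1, 1)) =
        2 * G (x, 0) - (G (x - 1, 1) + G (x + 1, 1)) := by
    rw [Gcur]
    rcases hx.eq_or_lt with rfl | h0
    · rw [Int.cast_zero, axisCurrent_zero, ← hsrc]
      norm_num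
      ring
    · rw [hrefl x h0 he, sub_self]
      obtain ⟨m, rfl⟩ := he
      obtain ⟨k, rfl⟩ : ∃ k : ℕ, m = k + 1 := ⟨(m - 1).toNat, by omega⟩
      rw [← axisCurrent_pos k]
      congr 1
      push_cast; ring
  have Gdecay (ε : ℝ) (hε : 0 < ε) : ∃ N : ℕ, ∀ x y : ℤ, 0 ≤ y → (N : ℤ) ≤ |x| + |y| →
      |g (x, y) - G (x, y)| < ε := by
    obtain ⟨M, hM⟩ := hdecay (ε / 2) (half_pos hε)
    obtain ⟨N, hN⟩ := voltage_decay (ε / 2) (half_pos hε)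
    refine ⟨M + N, fun x y hy hxy ↦ ?_⟩
    have h1 := hM x y (by omega)
    have h2 := hN x y.toNat (by rw [abs_of_nonneg hy] at hxy; omega)
    calc |g (x, y) - G (x, y)| ≤ |g (x, y)| + |G (x, y)| := abs_sub _ _
      _ < ε := by simp only [hG]; linarith
  have hle := slit_maximum_principle_s7 (h := fun p ↦ g p - G p)
    (fun x hx he ↦ by simp [hneg x hx, Gneg x hx he])
    (fun x y hy he ↦ by linarith [hharm x y hy he, Gharm x y hy])
    (fun x hx he ↦ by linarith [Grefl x hx he])
    Gdecay x y (by positivity) hxy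
  have hge := slit_maximum_principle_s7 (h := fun p ↦ G p - g p)
    (fun x hx he ↦ by simp [hneg x hx, Gneg x hx he])
    (fun x y hy he ↦ by linarith [hharm x y hy he, Gharm x y hy])
    (fun x hx he ↦ by linarith [Grefl x hx he])
    (fun ε hε ↦ by simpa only [abs_sub_comm] using Gdecay ε hε) x y (by positivity) hxy
  have : G (x, y) = voltage x y := by simp [hG]
  rw [← this]
  exact le_antisymm (sub_nonpos.1 hle) (sub_nonpos.1 hge)

/-- Every value of the slit-plane Green's function lies in the ring of dyadic
rationals with `√2` adjoined. -/
theorem slitGreen_values_dyadic_sqrt2 (g : ℤ × ℤ → ℝ) (hg : IsSlitGreen g) :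
    ∀ x y : ℤ, ∃ (a b : ℤ) (m : ℕ),
      g (x, y) = ((a : ℝ) + (b : ℝ) * Real.sqrt 2) / 2 ^ m := by
  intro x y
  change g (x, y) ∈ dyadicSqrtTwo
  by_cases h : y < 0 ∨ Odd (x + y)
  · rw [hg.1 x y h]
    exact zero_mem _
  · rw [not_or, not_lt, Int.not_odd_iff_even] at h
    obtain ⟨hy, hxy⟩ := h
    lift y to ℕ using hy
    rw [hg.eq_voltage x y hxy]
    exact voltage_mem hxy
end
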